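/- For every β ≥ 0, lim_{d→∞} limsup_{n→∞} | E_g[⟨R_{1,2}(σ1,σ2)²⟩_{β,g}] − E_A[⟨R_{1,2}(σ1,σ2)²⟩_{β/√d,A}] | = 0, where the inner Gibbs averages are over two independent samples from μ_{β,g} and from μ_{β/√d,A} respectively, and the outer expectations are over the SK disorder g and the sparse disorder A. -/

import Mathlib

open MeasureTheory ProbabilityTheory Filter

noncomputable section

/-- The value of a ±1 spin encoded as a Boolean. -/
def spin (b : Bool) : ℝ := if b then 1 else -1

/-- The Ising Hamiltonian `H(σ; X) = ∑_{i,j} X i j σ(i) σ(j)`. -/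
def Ham {n : ℕ} (X : Fin n → Fin n → ℝ) (σ : Fin n → Bool) : ℝ :=
  ∑ i, ∑ j, X i j * spin (σ i) * spin (σ j)

/-- The partition function `Z(β, X)`. -/
def Zpart {n : ℕ} (β : ℝ) (X : Fin n → Fin n → ℝ) : ℝ :=
  ∑ σ : Fin n → Bool, Real.exp (-β * Ham X σ)

/-- The Gibbs probability mass function `μ_{β,X}(σ)`. -/
def gibbs {n : ℕ} (β : ℝ) (X : Fin n → Fin n → ℝ) (σ : Fin n → Bool) : ℝ :=
  Real.exp (-β * Ham X σ) / Zpart β X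

/-- A configuration is a bisection if `|∑ i σ(i)| ≤ 1`. -/
def isBis {n : ℕ} (σ : Fin n → Bool) : Prop := |∑ i, spin (σ i)| ≤ 1

open scoped Classical in
/-- The bisection partition function `Z^bis(β, X)`. -/
def ZpartBis {n : ℕ} (β : ℝ) (X : Fin n → Fin n → ℝ) : ℝ :=
  ∑ σ : Fin n → Bool, if isBis σ then Real.exp (-β * Ham X σ) else 0

open scoped Classical in
/-- The bisection Gibbs probability mass function `μ^bis_{β,X}(σ)`. -/
def gibbsBis {n : ℕ} (β : ℝ) (X : Fin n → Fin n → ℝ) (σ : Fin n → Bool) : ℝ :=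
  if isBis σ then Real.exp (-β * Ham X σ) / ZpartBis β X else 0

/-- The overlap `R_{1,2}(σ1, σ2) = (1/n) ∑ i σ1(i) σ2(i)`. -/
def overlap {n : ℕ} (σ1 σ2 : Fin n → Bool) : ℝ :=
  (1 / (n : ℝ)) * ∑ i, spin (σ1 i) * spin (σ2 i)

/-- Gibbs average of a one-variable observable. -/
def avg1 {n : ℕ} (β : ℝ) (X : Fin n → Fin n → ℝ) (f : (Fin n → Bool) → ℝ) : ℝ :=
  ∑ σ : Fin n → Bool, f σ * gibbs β X σ

/-- Bisection Gibbs average of a one-variable observable. -/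
def avg1Bis {n : ℕ} (β : ℝ) (X : Fin n → Fin n → ℝ) (f : (Fin n → Bool) → ℝ) : ℝ :=
  ∑ σ : Fin n → Bool, f σ * gibbsBis β X σ

/-- Coupled Gibbs average: `σ1 ~ μ_{β,X}`, `σ2 ~ μ_{β,Y}` independent. -/
def avg2c {n : ℕ} (β : ℝ) (X Y : Fin n → Fin n → ℝ)
    (f : (Fin n → Bool) → (Fin n → Bool) → ℝ) : ℝ :=
  ∑ σ1 : Fin n → Bool, ∑ σ2 : Fin n → Bool, f σ1 σ2 * gibbs β X σ1 * gibbs β Y σ2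

/-- Gibbs average of a two-replica observable. -/
def avg2 {n : ℕ} (β : ℝ) (X : Fin n → Fin n → ℝ)
    (f : (Fin n → Bool) → (Fin n → Bool) → ℝ) : ℝ :=
  avg2c β X X f

/-- Coupled bisection Gibbs average. -/
def avg2cBis {n : ℕ} (β : ℝ) (X Y : Fin n → Fin n → ℝ)
    (f : (Fin n → Bool) → (Fin n → Bool) → ℝ) : ℝ :=
  ∑ σ1 : Fin n → Bool, ∑ σ2 : Fin n → Bool, f σ1 σ2 * gibbsBis β X σ1 * gibbsBis β Y σ2

/-- Bisection Gibbs average of a two-replica observable. -/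
def avg2Bis {n : ℕ} (β : ℝ) (X : Fin n → Fin n → ℝ)
    (f : (Fin n → Bool) → (Fin n → Bool) → ℝ) : ℝ :=
  avg2cBis β X X f

/-- The SK disorder: i.i.d. entries `N(0, 1/(2n))`. -/
def skMeasure (n : ℕ) : Measure (Fin n → Fin n → ℝ) :=
  Measure.pi fun _ => Measure.pi fun _ => gaussianReal 0 (1 / (2 * n))

/-- The law of the pair `(g, g')` of independent SK disorders. -/
def skPair (n : ℕ) : Measure ((Fin n → Fin n → ℝ) × (Fin n → Fin n → ℝ)) :=
  (skMeasure n).prod (skMeasure n)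

/-- The perturbed SK disorder `g_t = √(1-t) g + √t g'`. -/
def skPerturb {n : ℕ} (t : ℝ) (g g' : Fin n → Fin n → ℝ) : Fin n → Fin n → ℝ :=
  fun i j => Real.sqrt (1 - t) * g i j + Real.sqrt t * g' i j

/-- The sparse disorder: i.i.d. entries `Poisson(d/(2n))`. -/
def sparseMeasure (n : ℕ) (d : ℝ) : Measure (Fin n → Fin n → ℕ) :=
  Measure.pi fun _ => Measure.pi fun _ => poissonMeasure (d / (2 * n)).toNNReal

/-- The law of the triple `(A^{(1-t)}, A^{(t,1)}, A^{(t,2)})` of independent sparse disorders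
used to build the coupled pair `A = A^{(1-t)} + A^{(t,1)}`, `A_t = A^{(1-t)} + A^{(t,2)}`. -/
def coupledSparse (n : ℕ) (d t : ℝ) :
    Measure ((Fin n → Fin n → ℕ) × (Fin n → Fin n → ℕ) × (Fin n → Fin n → ℕ)) :=
  (sparseMeasure n ((1 - t) * d)).prod
    ((sparseMeasure n (t * d)).prod (sparseMeasure n (t * d)))

/-- View an ℕ-valued matrix as a real matrix. -/
def natMat {n : ℕ} (A : Fin n → Fin n → ℕ) : Fin n → Fin n → ℝ := fun i j => (A i j : ℝ)

/-- The Gibbs measure `μ_{β,X}` as a probability measure on configurations. -/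
def gibbsMeasure {n : ℕ} (β : ℝ) (X : Fin n → Fin n → ℝ) : Measure (Fin n → Bool) :=
  ∑ σ : Fin n → Bool, ENNReal.ofReal (gibbs β X σ) • Measure.dirac σ

/-- The bisection Gibbs measure `μ^bis_{β,X}` as a measure on configurations. -/
def gibbsBisMeasure {n : ℕ} (β : ℝ) (X : Fin n → Fin n → ℝ) : Measure (Fin n → Bool) :=
  ∑ σ : Fin n → Bool, ENNReal.ofReal (gibbsBis β X σ) • Measure.dirac σ

/-- Normalized Wasserstein distance `W_{2,n}` between measures on `{-1,1}^n`. -/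
def W2 (n : ℕ) (μ1 μ2 : Measure (Fin n → Bool)) : ℝ :=
  sInf {r : ℝ | ∃ π : Measure ((Fin n → Bool) × (Fin n → Bool)),
    IsProbabilityMeasure π ∧ π.map Prod.fst = μ1 ∧ π.map Prod.snd = μ2 ∧
    r = Real.sqrt (∫ p, (1 / (n : ℝ)) * ∑ i, (spin (p.1 i) - spin (p.2 i)) ^ 2 ∂π)}

open scoped Classical in
/-- Overlap-restricted coupled partition function `Z^S_{X,Y}`. -/
def Zres {n : ℕ} (β : ℝ) (S : Set ℝ) (X Y : Fin n → Fin n → ℝ) : ℝ :=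
  ∑ σ1 : Fin n → Bool, ∑ σ2 : Fin n → Bool,
    if overlap σ1 σ2 ∈ S then Real.exp (-β * (Ham X σ1 + Ham Y σ2)) else 0

open scoped Classical in
/-- Overlap-restricted coupled bisection partition function `Z^{S,bis}_{X,Y}`. -/
def ZresBis {n : ℕ} (β : ℝ) (S : Set ℝ) (X Y : Fin n → Fin n → ℝ) : ℝ :=
  ∑ σ1 : Fin n → Bool, ∑ σ2 : Fin n → Bool,
    if isBis σ1 ∧ isBis σ2 ∧ overlap σ1 σ2 ∈ S
    then Real.exp (-β * (Ham X σ1 + Ham Y σ2)) else 0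

/-- The matrix with a single `1` in position `(i,j)`. -/
def Jmat {n : ℕ} (i j : Fin n) : Fin n → Fin n → ℝ :=
  fun a b => if a = i ∧ b = j then 1 else 0

end

noncomputable section

/-! ### Finite Gibbs measures -/

section FiniteGibbs

variable {S : Type*} [Fintype S]

/-- The log-partition function of the (negative) energy `H`. -/
def logSumExp (H : S → ℝ) : ℝ := Real.log (∑ σ, Real.exp (H σ))

/-- The average of `f` under the Gibbs measure proportional to `exp H`. -/
def gibbsAvg (H f : S → ℝ) : ℝ := (∑ σ, f σ * Real.exp (H σ)) / ∑ σ, Real.exp (H σ)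

lemma gibbsAvg_sum {E : Type*} (t : Finset E) (H : S → ℝ) (c : E → ℝ) (f : E → S → ℝ) :
    gibbsAvg H (fun σ => ∑ e ∈ t, c e * f e σ) = ∑ e ∈ t, c e * gibbsAvg H (f e) := by
  unfold gibbsAvg
  simp_rw [Finset.sum_mul]
  rw [Finset.sum_comm, Finset.sum_div]
  refine Finset.sum_congr rfl fun e _ => ?_
  rw [← mul_div_assoc, Finset.mul_sum]
  simp_rw [mul_assoc]

variable [Nonempty S]

lemma sum_exp_pos (H : S → ℝ) : 0 < ∑ σ, Real.exp (H σ) :=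
  Finset.sum_pos (fun _ _ => Real.exp_pos _) Finset.univ_nonempty

lemma gibbsAvg_mono (H : S → ℝ) {f g : S → ℝ} (h : ∀ σ, f σ ≤ g σ) :
    gibbsAvg H f ≤ gibbsAvg H g :=
  div_le_div_of_nonneg_right
    (Finset.sum_le_sum fun σ _ => mul_le_mul_of_nonneg_right (h σ) (Real.exp_pos _).le)
    (sum_exp_pos H).le

lemma gibbsAvg_const (H : S → ℝ) (c : ℝ) : gibbsAvg H (fun _ => c) = c := by
  unfold gibbsAvg
  rw [← Finset.mul_sum, mul_div_assoc, div_self (sum_exp_pos H).ne', mul_one]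

lemma abs_gibbsAvg_le (H : S → ℝ) {f : S → ℝ} {c : ℝ} (h : ∀ σ, |f σ| ≤ c) :
    |gibbsAvg H f| ≤ c := by
  rw [abs_le]
  constructor
  · rw [← gibbsAvg_const H (-c)]
    exact gibbsAvg_mono H fun σ => (abs_le.1 (h σ)).1
  · rw [← gibbsAvg_const H c]
    exact gibbsAvg_mono H fun σ => (abs_le.1 (h σ)).2

/-- The Gibbs variational inequality: `logSumExp` lies above its tangents. -/
lemma gibbsAvg_sub_le (H K : S → ℝ) :
    gibbsAvg H (fun σ => K σ - H σ) ≤ logSumExp K - logSumExp H := by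
  have hZ := sum_exp_pos H
  have hK := sum_exp_pos K
  set a := gibbsAvg H (fun σ => K σ - H σ) with ha
  have key : Real.exp a * ∑ σ, Real.exp (H σ) ≤ ∑ σ, Real.exp (K σ) := by
    have h1 : ∀ σ, Real.exp a * (Real.exp (H σ) * (1 + (K σ - H σ - a))) ≤ Real.exp (K σ) := by
      intro σ
      have : Real.exp (K σ) = Real.exp a * (Real.exp (H σ) * Real.exp (K σ - H σ - a)) := by
        rw [← Real.exp_add, ← Real.exp_add]; ring_nf
      rw [this]
      gcongr
      linarith [Real.add_one_le_exp (K σ - H σ - a)]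
    refine le_trans (le_of_eq ?_) (Finset.sum_le_sum fun σ _ => h1 σ)
    rw [← Finset.mul_sum]
    congr 1
    have h2 : ∑ σ, (K σ - H σ) * Real.exp (H σ) = a * ∑ σ, Real.exp (H σ) := by
      rw [ha, gibbsAvg, div_mul_cancel₀ _ hZ.ne']
    have h3 : ∀ σ, Real.exp (H σ) * (1 + (K σ - H σ - a)) =
        Real.exp (H σ) + (K σ - H σ) * Real.exp (H σ) - a * Real.exp (H σ) := fun σ => by ring
    simp_rw [h3]
    rw [Finset.sum_sub_distrib, Finset.sum_add_distrib, h2, ← Finset.mul_sum]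
    ring
  have := Real.log_le_log (by positivity) key
  rw [Real.log_mul (Real.exp_pos _).ne' hZ.ne', Real.log_exp] at this
  unfold logSumExp
  linarith

lemma abs_logSumExp_sub_le (H K : S → ℝ) {c : ℝ} (h : ∀ σ, |K σ - H σ| ≤ c) :
    |logSumExp K - logSumExp H| ≤ c := by
  have h1 := (abs_le.1 (abs_gibbsAvg_le H h)).1
  have h2 := (abs_le.1 (abs_gibbsAvg_le K (f := fun σ => H σ - K σ) (c := c)
    fun σ => by rw [abs_sub_comm]; exact h σ)).1
  rw [abs_le]
  constructor <;> linarith [gibbsAvg_sub_le H K, gibbsAvg_sub_le K H]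

lemma gibbsAvg_sq_form_nonneg {E : Type*} [Fintype E] (H : S → ℝ) (c : E → ℝ) (s : E → S → ℝ)
    (h : ∀ σ τ, 0 ≤ ∑ e, c e * (s e σ * s e τ)) :
    0 ≤ ∑ e, c e * gibbsAvg H (s e) ^ 2 := by
  have h1 : ∑ e, c e * gibbsAvg H (s e) ^ 2 =
      gibbsAvg H (fun σ => gibbsAvg H fun τ => ∑ e, c e * (s e σ * s e τ)) := by
    have : ∀ σ, (gibbsAvg H fun τ => ∑ e, c e * (s e σ * s e τ)) =
        ∑ e, (c e * gibbsAvg H (s e)) * s e σ := by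
      intro σ
      have := gibbsAvg_sum Finset.univ H (fun e => c e * s e σ) s
      simp_rw [mul_assoc] at this
      rw [this]
      exact Finset.sum_congr rfl fun e _ => by ring
    simp_rw [this]
    rw [gibbsAvg_sum]
    exact Finset.sum_congr rfl fun e _ => by ring
  rw [h1, ← gibbsAvg_const H 0]
  exact gibbsAvg_mono H fun σ => by
    rw [← gibbsAvg_const H 0]
    exact gibbsAvg_mono H (h σ)

lemma hasDerivAt_logSumExp {G : ℝ → S → ℝ} {G' : S → ℝ} {t : ℝ}
    (hG : ∀ σ, HasDerivAt (fun t => G t σ) (G' σ) t) :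
    HasDerivAt (fun t => logSumExp (G t)) (gibbsAvg (G t) G') t := by
  have h : HasDerivAt (fun t => ∑ σ, Real.exp (G t σ)) (∑ σ, G' σ * Real.exp (G t σ)) t :=
    HasDerivAt.fun_sum fun σ _ => (hG σ).exp.congr_deriv (by ring)
  exact h.log (sum_exp_pos _).ne'

lemma hasDerivAt_logSumExp_line (H s : S → ℝ) (t : ℝ) :
    HasDerivAt (fun t => logSumExp fun σ => H σ + t * s σ)
      (gibbsAvg (fun σ => H σ + t * s σ) s) t :=
  hasDerivAt_logSumExp (G := fun t σ => H σ + t * s σ) fun σ =>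
    (((hasDerivAt_id' t).mul_const (s σ)).const_add (H σ)).congr_deriv (by ring)

lemma hasDerivAt_gibbsAvg_line (H s : S → ℝ) (hs : ∀ σ, s σ ^ 2 = 1) (t : ℝ) :
    HasDerivAt (fun t => gibbsAvg (fun σ => H σ + t * s σ) s)
      (1 - gibbsAvg (fun σ => H σ + t * s σ) s ^ 2) t := by
  have he : ∀ σ, HasDerivAt (fun t => Real.exp (H σ + t * s σ))
      (s σ * Real.exp (H σ + t * s σ)) t := fun σ =>
    ((((hasDerivAt_id' t).mul_const (s σ)).const_add (H σ)).exp).congr_deriv (by ring)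
  have h : HasDerivAt (fun t => ∑ σ, Real.exp (H σ + t * s σ))
      (∑ σ, s σ * Real.exp (H σ + t * s σ)) t :=
    HasDerivAt.fun_sum fun σ _ => he σ
  have h' : HasDerivAt (fun t => ∑ σ, s σ * Real.exp (H σ + t * s σ))
      (∑ σ, Real.exp (H σ + t * s σ)) t := by
    refine HasDerivAt.fun_sum fun σ _ => ?_
    exact ((he σ).const_mul (s σ)).congr_deriv (by rw [← mul_assoc, ← sq, hs, one_mul])
  have hZ := sum_exp_pos fun σ => H σ + t * s σ
  refine (h'.fun_div h hZ.ne').congr_deriv ?_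
  unfold gibbsAvg
  field_simp

end FiniteGibbs

/-! ### Taylor estimates for the free energy along one coupling -/

section Taylor

variable {f T : ℝ → ℝ}

lemma abs_le_of_deriv_bound {g g' : ℝ → ℝ} {c : ℝ} (k : ℕ) (h0 : g 0 = 0)
    (hg : ∀ t, HasDerivAt g (g' t) t) (hb : ∀ t, |g' t| ≤ c * (k + 1) * |t| ^ k) (t : ℝ) :
    |g t| ≤ c * |t| ^ (k + 1) := by
  have pos : ∀ (g g' : ℝ → ℝ), g 0 = 0 → (∀ t, HasDerivAt g (g' t) t) →
      (∀ t, |g' t| ≤ c * (k + 1) * |t| ^ k) → ∀ t, 0 ≤ t → g t ≤ c * t ^ (k + 1) := by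
    intro g g' h0 hg hb t ht
    have hd : ∀ x, HasDerivAt (fun t => g t - c * t ^ (k + 1))
        (g' x - c * ((k + 1 : ℕ) * x ^ k)) x := fun x =>
      ((hg x).fun_sub ((hasDerivAt_pow (k + 1) x).const_mul c)).congr_deriv (by simp)
    have := (antitoneOn_of_deriv_nonpos (convex_Ici (0 : ℝ))
      (f := fun t => g t - c * t ^ (k + 1))
      (fun x _ => (hd x).continuousAt.continuousWithinAt)
      (fun x _ => (hd x).differentiableAt.differentiableWithinAt)
      (fun x hx => by
        rw [interior_Ici] at hx
        rw [(hd x).deriv]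
        have h1 := (abs_le.1 (hb x)).2
        rw [abs_of_pos hx] at h1
        push_cast
        nlinarith)) (Set.self_mem_Ici) (Set.mem_Ici.2 ht) ht
    simp only [h0] at this
    have h3 : c * (0 : ℝ) ^ (k + 1) = 0 := by simp
    linarith
  have hneg : ∀ (g g' : ℝ → ℝ), (∀ t, HasDerivAt g (g' t) t) →
      ∀ t, HasDerivAt (fun t => g (-t)) (-g' (-t)) t := fun g g' hg t =>
    ((hg (-t)).comp t (hasDerivAt_neg t)).congr_deriv (by ring)
  have habs : ∀ (g g' : ℝ → ℝ), g 0 = 0 → (∀ t, HasDerivAt g (g' t) t) →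
      (∀ t, |g' t| ≤ c * (k + 1) * |t| ^ k) → ∀ t, 0 ≤ t → |g t| ≤ c * t ^ (k + 1) := by
    intro g g' h0 hg hb t ht
    rw [abs_le]
    constructor
    · have := pos (fun t => -g t) (fun t => -g' t) (by simp [h0]) (fun t => (hg t).neg)
        (fun t => by rw [abs_neg]; exact hb t) t ht
      linarith
    · exact pos g g' h0 hg hb t ht
  rcases le_total 0 t with ht | ht
  · rw [abs_of_nonneg ht]; exact habs g g' h0 hg hb t ht
  · have := habs (fun t => g (-t)) (fun t => -g' (-t)) (by simp [h0]) (hneg g g' hg)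
      (fun t => by rw [abs_neg]; simpa using hb (-t)) (-t) (by linarith)
    rw [abs_of_nonpos ht]
    simpa using this

lemma abs_one_sub_sq_le {x : ℝ} (hx : |x| ≤ 1) : |1 - x ^ 2| ≤ 1 := by
  have := sq_abs x
  rw [abs_le]; constructor <;> nlinarith [abs_nonneg x]

lemma abs_sub_le_of_riccati (hT : ∀ t, HasDerivAt T (1 - T t ^ 2) t) (hb : ∀ t, |T t| ≤ 1)
    (t : ℝ) : |T t - T 0| ≤ |t| := by
  have := abs_le_of_deriv_bound (c := 1) 0 (g := fun t => T t - T 0) (by simp)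
    (fun t => (hT t).sub_const _) (fun t => by simpa using abs_one_sub_sq_le (hb t)) t
  simpa using this

lemma abs_sq_sub_sq_le_of_riccati (hT : ∀ t, HasDerivAt T (1 - T t ^ 2) t)
    (hb : ∀ t, |T t| ≤ 1) (t : ℝ) : |T t ^ 2 - T 0 ^ 2| ≤ 2 * |t| := by
  have h : T t ^ 2 - T 0 ^ 2 = (T t + T 0) * (T t - T 0) := by ring
  rw [h, abs_mul]
  exact mul_le_mul ((abs_add_le _ _).trans (by linarith [hb t, hb 0]))
    (abs_sub_le_of_riccati hT hb t) (abs_nonneg _) (by norm_num)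

lemma abs_taylor_one_le_of_riccati (hT : ∀ t, HasDerivAt T (1 - T t ^ 2) t)
    (hb : ∀ t, |T t| ≤ 1) (t : ℝ) : |T t - T 0 - (1 - T 0 ^ 2) * t| ≤ t ^ 2 := by
  have := abs_le_of_deriv_bound (c := 1) 1 (g := fun t => T t - T 0 - (1 - T 0 ^ 2) * t) (by simp)
    (fun t => ((hT t).sub_const _).sub ((hasDerivAt_id t).const_mul _)) (fun t => by
      have := abs_sq_sub_sq_le_of_riccati hT hb t
      rw [abs_sub_comm] at this
      convert this using 1
      · congr 1; ring
      · norm_num) t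
  simpa using this

lemma abs_taylor_two_le_of_riccati (hf : ∀ t, HasDerivAt f (T t) t)
    (hT : ∀ t, HasDerivAt T (1 - T t ^ 2) t) (hb : ∀ t, |T t| ≤ 1) (t : ℝ) :
    |f t - (f 0 + T 0 * t + (1 - T 0 ^ 2) * (t ^ 2 / 2))| ≤ |t| ^ 3 / 3 := by
  have := abs_le_of_deriv_bound (c := 1 / 3) 2
    (g := fun t => f t - (f 0 + T 0 * t + (1 - T 0 ^ 2) * (t ^ 2 / 2))) (by simp)
    (fun t => (hf t).sub ((((hasDerivAt_id t).const_mul (T 0)).const_add (f 0)).add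
      (((hasDerivAt_pow 2 t).div_const 2).const_mul (1 - T 0 ^ 2)))) (fun t => by
      have := abs_taylor_one_le_of_riccati hT hb t
      convert this using 1
      · congr 1; simp; ring
      · norm_num) t
  calc _ ≤ _ := this
    _ = _ := by ring

end Taylor

/-! ### Product measures -/

section ProductMeasure

variable {E : Type*} [Fintype E]

/-- Resampling one coordinate of a product measure. -/
lemma measurePreserving_update_pi [DecidableEq E] {X : Type*} [MeasurableSpace X]
    (μ μ' : E → Measure X)
    [∀ i, IsProbabilityMeasure (μ i)] [∀ i, IsProbabilityMeasure (μ' i)] (e : E)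
    (h : ∀ i, i ≠ e → μ' i = μ i) :
    MeasurePreserving (fun p : (E → X) × X => Function.update p.1 e p.2)
      ((Measure.pi μ).prod (μ' e)) (Measure.pi μ') := by
  have hm : Measurable (fun p : (E → X) × X => Function.update p.1 e p.2) := by
    refine measurable_pi_lambda _ fun i => ?_
    by_cases hi : i = e
    · subst hi; simpa using measurable_snd
    · simp only [Function.update_of_ne hi]
      exact (measurable_pi_apply i).comp measurable_fst
  refine ⟨hm, (Measure.pi_eq fun s hs => ?_).symm⟩
  rw [Measure.map_apply hm (MeasurableSet.univ_pi hs)]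
  have : (fun p : (E → X) × X => Function.update p.1 e p.2) ⁻¹' Set.univ.pi s =
      (Set.univ.pi (Function.update s e Set.univ)) ×ˢ s e := by
    ext p
    simp only [Set.mem_preimage, Set.mem_univ_pi, Set.mem_prod]
    constructor
    · intro hp
      refine ⟨fun i => ?_, by simpa using hp e⟩
      by_cases hi : i = e
      · subst hi; simp
      · simpa [Function.update_of_ne hi] using hp i
    · rintro ⟨h1, h2⟩ i
      by_cases hi : i = e
      · subst hi; simpa using h2
      · simpa [Function.update_of_ne hi] using h1 i
  rw [this, Measure.prod_prod, Measure.pi_pi, ← Finset.mul_prod_erase _ _ (Finset.mem_univ e),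
    ← Finset.mul_prod_erase (a := e) _ _ (Finset.mem_univ e)]
  simp only [Function.update_self, measure_univ, one_mul]
  rw [mul_comm]
  congr 1
  refine Finset.prod_congr rfl fun i hi => ?_
  have hi' := Finset.ne_of_mem_erase hi
  rw [Function.update_of_ne hi', h i hi']

lemma integrable_update_pi [DecidableEq E] {X : Type*} [MeasurableSpace X] {μ μ' : E → Measure X}
    [∀ i, IsProbabilityMeasure (μ i)] [∀ i, IsProbabilityMeasure (μ' i)] {e : E}
    (h : ∀ i, i ≠ e → μ' i = μ i) {F : (E → X) → ℝ} (hF : Integrable F (Measure.pi μ')) :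
    Integrable (fun p : (E → X) × X => F (Function.update p.1 e p.2))
      ((Measure.pi μ).prod (μ' e)) :=
  (measurePreserving_update_pi μ μ' e h).integrable_comp_of_integrable hF

lemma integral_pi_eq_integral_update [DecidableEq E] {X : Type*} [MeasurableSpace X]
    {μ μ' : E → Measure X}
    [∀ i, IsProbabilityMeasure (μ i)] [∀ i, IsProbabilityMeasure (μ' i)] {e : E}
    (h : ∀ i, i ≠ e → μ' i = μ i) {F : (E → X) → ℝ} (hF : Integrable F (Measure.pi μ')) :
    ∫ x, F x ∂Measure.pi μ' =
      ∫ x, ∫ t, F (Function.update x e t) ∂(μ' e) ∂Measure.pi μ := by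
  have hp := measurePreserving_update_pi μ μ' e h
  rw [← integral_prod _ (integrable_update_pi h hF), ← hp.map_eq,
    integral_map hp.measurable.aemeasurable]
  rw [hp.map_eq]
  exact hF.aestronglyMeasurable

/-- Product measures are compatible with pulling back along an injection of index types. -/
lemma measurePreserving_comp_pi {E' X : Type*} [Fintype E'] [MeasurableSpace X]
    (μ : Measure X) [IsProbabilityMeasure μ] {f : E' → E} (hf : Function.Injective f) :
    MeasurePreserving (fun x : E → X => x ∘ f) (Measure.pi fun _ => μ)
      (Measure.pi fun _ => μ) := by
  classical
  have hm : Measurable (fun x : E → X => x ∘ f) :=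
    measurable_pi_lambda _ fun i => measurable_pi_apply (f i)
  refine ⟨hm, (Measure.pi_eq fun s hs => ?_).symm⟩
  rw [Measure.map_apply hm (MeasurableSet.univ_pi hs)]
  have : (fun x : E → X => x ∘ f) ⁻¹' Set.univ.pi s =
      Set.univ.pi (fun e => if h : ∃ i, f i = e then s h.choose else Set.univ) := by
    ext x
    simp only [Set.mem_preimage, Set.mem_univ_pi, Function.comp]
    constructor
    · intro hx e
      by_cases h : ∃ i, f i = e
      · rw [dif_pos h]
        have := hx h.choose
        rwa [h.choose_spec] at this
      · rw [dif_neg h]; trivial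
    · intro hx i
      have h : ∃ j, f j = f i := ⟨i, rfl⟩
      have := hx (f i)
      rw [dif_pos h, hf h.choose_spec] at this
      exact this
  rw [this, Measure.pi_pi, ← Finset.prod_subset (Finset.subset_univ (Finset.univ.image f)),
    Finset.prod_image fun _ _ _ _ h => hf h]
  · refine Finset.prod_congr rfl fun i _ => ?_
    have h : ∃ j, f j = f i := ⟨i, rfl⟩
    rw [dif_pos h, hf h.choose_spec]
  · intro e _ he
    rw [dif_neg, measure_univ]
    rintro ⟨i, rfl⟩
    exact he (Finset.mem_image_of_mem f (Finset.mem_univ i))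

lemma measurePreserving_curry_pi {V W X : Type*} [Fintype V] [Fintype W] [MeasurableSpace X]
    (μ : Measure X) [IsProbabilityMeasure μ] :
    MeasurePreserving (fun (x : V → W → X) (e : V × W) => x e.1 e.2)
      (Measure.pi fun _ => Measure.pi fun _ => μ) (Measure.pi fun _ => μ) := by
  have hm : Measurable (fun (x : V → W → X) (e : V × W) => x e.1 e.2) :=
    measurable_pi_lambda _ fun e => (measurable_pi_apply e.2).comp (measurable_pi_apply e.1)
  refine ⟨hm, (Measure.pi_eq fun s hs => ?_).symm⟩
  rw [Measure.map_apply hm (MeasurableSet.univ_pi hs)]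
  have : (fun (x : V → W → X) (e : V × W) => x e.1 e.2) ⁻¹' Set.univ.pi s =
      Set.univ.pi (fun v => Set.univ.pi fun w => s (v, w)) := by
    ext x
    simp
  rw [this, Measure.pi_pi]
  simp_rw [Measure.pi_pi]
  rw [Fintype.prod_prod_type]

lemma integrable_sum_abs_pi (μ : E → Measure ℝ) [∀ i, IsProbabilityMeasure (μ i)]
    (h : ∀ i, Integrable id (μ i)) (c : E → ℝ) :
    Integrable (fun x : E → ℝ => ∑ e, c e * |x e|) (Measure.pi μ) :=
  integrable_finsetSum _ fun e _ =>
    (((measurePreserving_eval μ e).integrable_comp_of_integrable (h e)).abs).const_mul (c e)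

end ProductMeasure

/-! ### Energies that are affine in the couplings -/

section Energy

variable {S E : Type*} [Fintype E]

/-- The energy with base part `k`, couplings `x` and interaction terms `s`. -/
def energy (k : S → ℝ) (s : E → S → ℝ) (x : E → ℝ) (σ : S) : ℝ := k σ + ∑ e, x e * s e σ

lemma energy_update [DecidableEq E] (k : S → ℝ) (s : E → S → ℝ) (x : E → ℝ) (e : E) (t : ℝ)
    (a : E → ℝ) :
    energy k s (fun i => a i * Function.update x e t i) =
      fun σ => energy k s (fun i => a i * Function.update x e 0 i) σ + (a e * t) * s e σ := by
  funext σ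
  unfold energy
  rw [← Finset.add_sum_erase _ _ (Finset.mem_univ e),
    ← Finset.add_sum_erase (a := e) _ _ (Finset.mem_univ e)]
  have : ∀ t, ∑ i ∈ Finset.univ.erase e, a i * Function.update x e t i * s i σ =
      ∑ i ∈ Finset.univ.erase e, a i * x i * s i σ := fun t =>
    Finset.sum_congr rfl fun i hi => by rw [Function.update_of_ne (Finset.ne_of_mem_erase hi)]
  rw [this, this]
  simp only [Function.update_self]
  ring

lemma continuous_energy (k : S → ℝ) (s : E → S → ℝ) (σ : S) :
    Continuous fun x => energy k s x σ := by
  unfold energy; fun_prop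

variable [Fintype S] [Nonempty S]

lemma continuous_logSumExp_energy (k : S → ℝ) (s : E → S → ℝ) :
    Continuous fun x => logSumExp (energy k s x) := by
  unfold logSumExp
  refine Continuous.log ?_ fun x => (sum_exp_pos _).ne'
  exact continuous_finsetSum _ fun σ _ => Real.continuous_exp.comp (continuous_energy k s σ)

lemma continuous_gibbsAvg_energy (k : S → ℝ) (s : E → S → ℝ) (f : S → ℝ) :
    Continuous fun x => gibbsAvg (energy k s x) f := by
  unfold gibbsAvg
  refine Continuous.div ?_ ?_ fun x => (sum_exp_pos _).ne'
  · exact continuous_finsetSum _ fun σ _ =>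
      continuous_const.mul (Real.continuous_exp.comp (continuous_energy k s σ))
  · exact continuous_finsetSum _ fun σ _ => Real.continuous_exp.comp (continuous_energy k s σ)

lemma abs_logSumExp_energy_le (k : S → ℝ) {s : E → S → ℝ} (hs : ∀ e σ, |s e σ| ≤ 1)
    (x : E → ℝ) : |logSumExp (energy k s x)| ≤ |logSumExp k| + ∑ e, |x e| := by
  have := abs_logSumExp_sub_le k (energy k s x) (c := ∑ e, |x e|) fun σ => by
    simp only [energy, add_sub_cancel_left]
    refine (Finset.abs_sum_le_sum_abs _ _).trans (Finset.sum_le_sum fun e _ => ?_)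
    rw [abs_mul]
    exact mul_le_of_le_one_right (abs_nonneg _) (hs e σ)
  have h2 := abs_sub_abs_le_abs_sub (logSumExp (energy k s x)) (logSumExp k)
  linarith

lemma abs_le_one_of_sq {s : ℝ} (h : s ^ 2 = 1) : |s| ≤ 1 := by
  rw [← sq_abs] at h; nlinarith [abs_nonneg s]

lemma integrable_logSumExp_energy (k : S → ℝ) {s : E → S → ℝ} (hs : ∀ e σ, s e σ ^ 2 = 1)
    (μ : E → Measure ℝ) [∀ i, IsProbabilityMeasure (μ i)] (h : ∀ i, Integrable id (μ i))
    (a : E → ℝ) :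
    Integrable (fun x : E → ℝ => logSumExp (energy k s fun e => a e * x e)) (Measure.pi μ) := by
  refine Integrable.mono' ((integrable_const |logSumExp k|).add
    (integrable_sum_abs_pi μ h fun e => |a e|))
    ((continuous_logSumExp_energy k s).comp (by fun_prop)).aestronglyMeasurable
    (ae_of_all _ fun x => ?_)
  have := abs_logSumExp_energy_le k (fun e σ => abs_le_one_of_sq (hs e σ)) fun e => a e * x e
  simpa [abs_mul] using this

lemma integrable_gibbsAvg_energy (k : S → ℝ) {s : E → S → ℝ} (hs : ∀ e σ, s e σ ^ 2 = 1)
    (μ : E → Measure ℝ) [∀ i, IsProbabilityMeasure (μ i)] (a : E → ℝ) (e : E) (m : ℕ) :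
    Integrable (fun x : E → ℝ => gibbsAvg (energy k s fun e => a e * x e) (s e) ^ m)
      (Measure.pi μ) := by
  refine Integrable.mono' (integrable_const (1 : ℝ))
    (((continuous_gibbsAvg_energy k s (s e)).comp
      (g := fun x => gibbsAvg (energy k s x) (s e)) (by fun_prop)).pow m).aestronglyMeasurable
    (ae_of_all _ fun x => ?_)
  rw [Real.norm_eq_abs, abs_pow]
  exact pow_le_one₀ (abs_nonneg _)
    (abs_gibbsAvg_le _ fun σ => abs_le_one_of_sq (hs e σ))

lemma integrable_mul_gibbsAvg_energy (k : S → ℝ) {s : E → S → ℝ} (hs : ∀ e σ, s e σ ^ 2 = 1)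
    (μ : E → Measure ℝ) [∀ i, IsProbabilityMeasure (μ i)] (h : ∀ i, Integrable id (μ i))
    (a : E → ℝ) (e : E) :
    Integrable (fun x : E → ℝ => x e * gibbsAvg (energy k s fun e => a e * x e) (s e))
      (Measure.pi μ) := by
  have h1 := ((measurePreserving_eval μ e).integrable_comp_of_integrable (h e))
  refine Integrable.mono' h1.abs ((Continuous.mul (by fun_prop)
    ((continuous_gibbsAvg_energy k s (s e)).comp
      (g := fun x => gibbsAvg (energy k s x) (s e)) (by fun_prop))).aestronglyMeasurable)
    (ae_of_all _ fun x => ?_)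
  rw [Real.norm_eq_abs, abs_mul]
  exact mul_le_of_le_one_right (abs_nonneg _)
    (abs_gibbsAvg_le _ fun σ => abs_le_one_of_sq (hs e σ))

end Energy

/-! ### Replacing the law of the couplings -/

/-- `ν` is a centered probability measure with variance `v` and third absolute moment at most
`ρ`. -/
structure IsCenteredLaw (ν : Measure ℝ) (v ρ : ℝ) : Prop where
  isProb : IsProbabilityMeasure ν
  integrable_cube : Integrable (fun t => |t| ^ 3) ν
  mean : ∫ t, t ∂ν = 0
  var : ∫ t, t ^ 2 ∂ν = v
  third : ∫ t, |t| ^ 3 ∂ν ≤ ρ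

namespace IsCenteredLaw

variable {ν : Measure ℝ} {v ρ : ℝ}

lemma integrable_id (h : IsCenteredLaw ν v ρ) : Integrable id ν := by
  have := h.isProb
  refine Integrable.mono' ((integrable_const (1 : ℝ)).add h.integrable_cube)
    measurable_id.aestronglyMeasurable (ae_of_all _ fun t => ?_)
  simp only [id, Real.norm_eq_abs, Pi.add_apply]
  have h0 := abs_nonneg t
  nlinarith [sq_nonneg (|t| - 1), mul_nonneg h0 (sq_nonneg (|t| - 1))]

lemma integrable_sq (h : IsCenteredLaw ν v ρ) : Integrable (fun t => t ^ 2) ν := by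
  have := h.isProb
  refine Integrable.mono' ((integrable_const (1 : ℝ)).add h.integrable_cube)
    (by fun_prop) (ae_of_all _ fun t => ?_)
  simp only [Real.norm_eq_abs, Pi.add_apply]
  rw [abs_of_nonneg (sq_nonneg t), ← sq_abs]
  have h0 := abs_nonneg t
  nlinarith [sq_nonneg (|t| - 1), mul_nonneg h0 (sq_nonneg (|t| - 1))]

lemma integral_abs_le (h : IsCenteredLaw ν v ρ) (hv : 0 < v) : ∫ t, |t| ∂ν ≤ √v := by
  have := h.isProb
  have hs : 0 < √v := Real.sqrt_pos.2 hv
  have h1 : ∫ t, |t| ∂ν ≤ ∫ t, (√v / 2 + t ^ 2 * (1 / (2 * √v))) ∂ν := by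
    refine integral_mono h.integrable_id.abs
      ((integrable_const _).add (h.integrable_sq.mul_const _)) fun t => ?_
    have : √v / 2 + t ^ 2 * (1 / (2 * √v)) - |t| = (√v - |t|) ^ 2 / (2 * √v) := by
      field_simp
      rw [← sq_abs t]; ring
    have h2 : 0 ≤ (√v - |t|) ^ 2 / (2 * √v) := by positivity
    show |t| ≤ _
    linarith
  refine h1.trans (le_of_eq ?_)
  rw [integral_add (integrable_const _) (h.integrable_sq.mul_const _), integral_mul_const, h.var]
  simp only [integral_const, probReal_univ, one_smul]
  field_simp
  rw [Real.sq_sqrt hv.le]; ring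

lemma abs_integral_sub_quadratic_le (h : IsCenteredLaw ν v ρ) {b : ℝ} (hb : 0 ≤ b)
    {f T : ℝ → ℝ} (hf : ∀ t, HasDerivAt f (T t) t)
    (hT : ∀ t, HasDerivAt T (1 - T t ^ 2) t) (hT1 : ∀ t, |T t| ≤ 1) :
    |∫ t, f (b * t) ∂ν - (f 0 + (1 - T 0 ^ 2) * (b ^ 2 * v / 2))| ≤ b ^ 3 * ρ / 3 := by
  have := h.isProb
  set q : ℝ → ℝ := fun t => f 0 + (T 0 * b) * t + ((1 - T 0 ^ 2) * b ^ 2 / 2) * t ^ 2 with hq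
  have hq_int : Integrable q ν := ((integrable_const _).add (h.integrable_id.const_mul _)).add
    (h.integrable_sq.const_mul _)
  have hbound : ∀ t, |f (b * t) - q t| ≤ b ^ 3 / 3 * |t| ^ 3 := fun t => by
    have := abs_taylor_two_le_of_riccati hf hT hT1 (b * t)
    rw [abs_mul, abs_of_nonneg hb] at this
    convert this using 1
    · congr 2; simp only [hq]; ring
    · ring
  have hfc : Continuous f := continuous_iff_continuousAt.2 fun t => (hf t).continuousAt
  have hd_int : Integrable (fun t => f (b * t) - q t) ν :=
    Integrable.mono' (h.integrable_cube.const_mul (b ^ 3 / 3))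
      (by apply Continuous.aestronglyMeasurable; fun_prop) (ae_of_all _ hbound)
  have hval : ∫ t, q t ∂ν = f 0 + (1 - T 0 ^ 2) * (b ^ 2 * v / 2) := by
    have l1 : Integrable (fun t => (T 0 * b) * t) ν := h.integrable_id.const_mul _
    have l2 : Integrable (fun t => f 0 + (T 0 * b) * t) ν := (integrable_const _).add l1
    simp only [hq]
    rw [integral_add l2 (h.integrable_sq.const_mul _), integral_add (integrable_const _) l1,
      integral_const_mul, integral_const_mul, h.var, h.mean]
    simp only [integral_const, probReal_univ, one_smul]
    ring
  have hsplit : ∫ t, f (b * t) ∂ν - ∫ t, q t ∂ν = ∫ t, (f (b * t) - q t) ∂ν := by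
    have hfi : Integrable (fun t => f (b * t)) ν := by
      have := hd_int.add hq_int
      refine this.congr (ae_of_all _ fun t => ?_)
      simp
    rw [integral_sub hfi hq_int]
  rw [← hval, hsplit]
  refine (abs_integral_le_integral_abs).trans ?_
  refine (integral_mono hd_int.abs (h.integrable_cube.const_mul (b ^ 3 / 3)) hbound).trans ?_
  rw [integral_const_mul]
  have : b ^ 3 / 3 * ∫ t, |t| ^ 3 ∂ν ≤ b ^ 3 / 3 * ρ :=
    mul_le_mul_of_nonneg_left h.third (by positivity)
  linarith

lemma abs_integral_mul_sub_le (h : IsCenteredLaw ν v ρ) (hv : 0 < v) {b : ℝ} (hb : 0 ≤ b)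
    {T : ℝ → ℝ} (hT : ∀ t, HasDerivAt T (1 - T t ^ 2) t) (hT1 : ∀ t, |T t| ≤ 1) :
    |∫ t, t * T (b * t) ∂ν - b * v * (1 - ∫ t, T (b * t) ^ 2 ∂ν)| ≤
      b ^ 2 * ρ + 2 * b ^ 2 * v * √v := by
  have := h.isProb
  have hTc : Continuous T := continuous_iff_continuousAt.2 fun t => (hT t).continuousAt
  have hsq_int : Integrable (fun t => T (b * t) ^ 2) ν := by
    refine Integrable.mono' (integrable_const (1 : ℝ))
      (by apply Continuous.aestronglyMeasurable; fun_prop) (ae_of_all _ fun t => ?_)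
    rw [Real.norm_eq_abs, abs_pow]
    exact pow_le_one₀ (abs_nonneg _) (hT1 _)
  have hm_int : Integrable (fun t => t * T (b * t)) ν := by
    refine Integrable.mono' h.integrable_id.abs
      (by apply Continuous.aestronglyMeasurable; fun_prop) (ae_of_all _ fun t => ?_)
    rw [Real.norm_eq_abs, abs_mul]
    exact mul_le_of_le_one_right (abs_nonneg _) (hT1 _)
  have h1 : |∫ t, t * T (b * t) ∂ν - b * v * (1 - T 0 ^ 2)| ≤ b ^ 2 * ρ := by
    have hq_int : Integrable (fun t => T 0 * t + ((1 - T 0 ^ 2) * b) * t ^ 2) ν :=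
      (h.integrable_id.const_mul _).add (h.integrable_sq.const_mul _)
    have hval : ∫ t, (T 0 * t + ((1 - T 0 ^ 2) * b) * t ^ 2) ∂ν = b * v * (1 - T 0 ^ 2) := by
      have l1 : Integrable (fun t => T 0 * t) ν := h.integrable_id.const_mul _
      rw [integral_add l1 (h.integrable_sq.const_mul _),
        integral_const_mul, integral_const_mul, h.var, h.mean]
      ring
    have hbound : ∀ t, |t * T (b * t) - (T 0 * t + ((1 - T 0 ^ 2) * b) * t ^ 2)| ≤
        b ^ 2 * |t| ^ 3 := fun t => by
      have := abs_taylor_one_le_of_riccati hT hT1 (b * t)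
      calc _ = |t| * |T (b * t) - T 0 - (1 - T 0 ^ 2) * (b * t)| := by
            rw [← abs_mul]; congr 1; ring
        _ ≤ |t| * (b * t) ^ 2 := mul_le_mul_of_nonneg_left this (abs_nonneg _)
        _ = b ^ 2 * |t| ^ 3 := by rw [mul_pow, ← sq_abs t]; ring
    rw [← hval, ← integral_sub hm_int hq_int]
    refine (abs_integral_le_integral_abs).trans ?_
    refine (integral_mono (hm_int.sub hq_int).abs (h.integrable_cube.const_mul (b ^ 2))
      hbound).trans ?_
    rw [integral_const_mul]
    exact mul_le_mul_of_nonneg_left h.third (by positivity)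
  have h2 : |∫ t, T (b * t) ^ 2 ∂ν - T 0 ^ 2| ≤ 2 * b * √v := by
    have : ∫ t, T (b * t) ^ 2 ∂ν - T 0 ^ 2 = ∫ t, (T (b * t) ^ 2 - T 0 ^ 2) ∂ν := by
      rw [integral_sub hsq_int (integrable_const _)]; simp
    rw [this]
    refine (abs_integral_le_integral_abs).trans ?_
    refine (integral_mono (hsq_int.sub (integrable_const _)).abs
      (h.integrable_id.abs.const_mul (2 * b)) (fun t => ?_)).trans ?_
    · have := abs_sq_sub_sq_le_of_riccati hT hT1 (b * t)
      rw [abs_mul, abs_of_nonneg hb, ← mul_assoc] at this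
      exact this
    · rw [integral_const_mul]
      exact mul_le_mul_of_nonneg_left (h.integral_abs_le hv) (by positivity)
  have h3 : |b * v * (∫ t, T (b * t) ^ 2 ∂ν - T 0 ^ 2)| ≤ b * v * (2 * b * √v) := by
    rw [abs_mul, abs_of_nonneg (by positivity : 0 ≤ b * v)]
    exact mul_le_mul_of_nonneg_left h2 (by positivity)
  have h4 := abs_add_le (∫ t, t * T (b * t) ∂ν - b * v * (1 - T 0 ^ 2))
    (b * v * (∫ t, T (b * t) ^ 2 ∂ν - T 0 ^ 2))
  calc _ = _ := by congr 1; ring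
    _ ≤ _ := h4
    _ ≤ _ := by nlinarith [h1, h3]

end IsCenteredLaw

section Lindeberg

variable {S E : Type*} [Fintype S] [Nonempty S] [Fintype E]
variable {s : E → S → ℝ} {v ρ ρ' b : ℝ}

/-- The expected free energy depends on the law of independent couplings only through its
variance, up to third moments. -/
lemma abs_integral_logSumExp_sub_le (k : S → ℝ) (hs : ∀ e σ, s e σ ^ 2 = 1) {ν γ : Measure ℝ}
    (hν : IsCenteredLaw ν v ρ) (hγ : IsCenteredLaw γ v ρ') (hb : 0 ≤ b) :
    |∫ x, logSumExp (energy k s fun e => b * x e) ∂(Measure.pi fun _ : E => ν) -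
      ∫ x, logSumExp (energy k s fun e => b * x e) ∂(Measure.pi fun _ : E => γ)| ≤
      Fintype.card E * (b ^ 3 * (ρ + ρ') / 3) := by
  classical
  have := hν.isProb
  have := hγ.isProb
  set μ : Finset E → E → Measure ℝ := fun A e => if e ∈ A then ν else γ with hμ
  have hprob : ∀ A e, IsProbabilityMeasure (μ A e) := fun A e => by
    simp only [hμ]; split_ifs <;> infer_instance
  have hInt : ∀ A e, Integrable id (μ A e) := fun A e => by
    simp only [hμ]; split_ifs
    exacts [hν.integrable_id, hγ.integrable_id]
  set F : (E → ℝ) → ℝ := fun x => logSumExp (energy k s fun e => b * x e) with hF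
  have hFint : ∀ A, Integrable F (Measure.pi (μ A)) := fun A =>
    integrable_logSumExp_energy k hs (μ A) (hInt A) fun _ => b
  have key : ∀ A : Finset E, |∫ x, F x ∂Measure.pi (μ A) - ∫ x, F x ∂Measure.pi (μ ∅)| ≤
      A.card * (b ^ 3 * (ρ + ρ') / 3) := by
    intro A
    induction A using Finset.induction_on with
    | empty => simp
    | insert e A he ih =>
      have hne : ∀ i, i ≠ e → μ (insert e A) i = μ A i := fun i hi => by
        simp [hμ, hi]
      have hν' : μ (insert e A) e = ν := by simp [hμ]
      have hγ' : μ A e = γ := by simp [hμ, he]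
      have i1 := (integrable_update_pi hne (hFint (insert e A))).integral_prod_left
      have i2 := (integrable_update_pi (fun _ _ => rfl) (hFint A) (e := e)).integral_prod_left
      have h1 := integral_pi_eq_integral_update hne (hFint (insert e A))
      have h2 := integral_pi_eq_integral_update (e := e) (fun _ _ => rfl) (hFint A)
      have hstep : |∫ x, F x ∂Measure.pi (μ (insert e A)) - ∫ x, F x ∂Measure.pi (μ A)| ≤
          b ^ 3 * (ρ + ρ') / 3 := by
        rw [h1, h2, ← integral_sub i1 i2]
        refine abs_integral_le_integral_abs.trans ?_
        refine (integral_mono (i1.sub i2).abs (integrable_const (b ^ 3 * (ρ + ρ') / 3))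
          fun x => ?_).trans (by simp)
        obtain ⟨H, hH⟩ : ∃ H : S → ℝ, ∀ t, energy k s (fun i => b * Function.update x e t i) =
            fun σ => H σ + (b * t) * s e σ := ⟨_, fun t => energy_update k s x e t fun _ => b⟩
        simp only [Pi.sub_apply, hν', hγ', hF, hH]
        have hf := hasDerivAt_logSumExp_line H (s e)
        have hT := hasDerivAt_gibbsAvg_line H (s e) (hs e)
        have hT1 : ∀ t, |gibbsAvg (fun σ => H σ + t * s e σ) (s e)| ≤ 1 := fun t =>
          abs_gibbsAvg_le _ fun σ => abs_le_one_of_sq (hs e σ)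
        have e1 := hν.abs_integral_sub_quadratic_le hb hf hT hT1
        have e2 := hγ.abs_integral_sub_quadratic_le hb hf hT hT1
        rw [abs_le] at e1 e2 ⊢
        constructor <;> linarith [e1.1, e1.2, e2.1, e2.2]
      rw [Finset.card_insert_of_notMem he]
      have := abs_sub_le (∫ x, F x ∂Measure.pi (μ (insert e A))) (∫ x, F x ∂Measure.pi (μ A))
        (∫ x, F x ∂Measure.pi (μ ∅))
      push_cast
      linarith
  have h1 : μ Finset.univ = fun _ => ν := by funext e; simp [hμ]
  have h2 : μ ∅ = fun _ => γ := by funext e; simp [hμ]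
  have := key Finset.univ
  rw [h1, h2] at this
  exact this

/-- Approximate integration by parts for a single coupling. -/
lemma abs_integral_mul_gibbsAvg_sub_le (k : S → ℝ) (hs : ∀ e σ, s e σ ^ 2 = 1) {ν : Measure ℝ}
    (hν : IsCenteredLaw ν v ρ) (hv : 0 < v) (hb : 0 ≤ b) (e : E) :
    |∫ x, x e * gibbsAvg (energy k s fun e => b * x e) (s e) ∂(Measure.pi fun _ : E => ν) -
      b * v * (1 - ∫ x, gibbsAvg (energy k s fun e => b * x e) (s e) ^ 2
        ∂(Measure.pi fun _ : E => ν))| ≤ b ^ 2 * ρ + 2 * b ^ 2 * v * √v := by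
  classical
  have := hν.isProb
  have j1 := integrable_mul_gibbsAvg_energy k hs (fun _ : E => ν) (fun _ => hν.integrable_id)
    (fun _ => b) e
  have j2 := integrable_gibbsAvg_energy k hs (fun _ : E => ν) (fun _ => b) e 2
  have i1 := (integrable_update_pi (fun _ _ => rfl) j1 (e := e)).integral_prod_left
  have i2 := (integrable_update_pi (fun _ _ => rfl) j2 (e := e)).integral_prod_left
  have h1 := integral_pi_eq_integral_update (e := e) (fun _ _ => rfl) j1
  have h2 := integral_pi_eq_integral_update (e := e) (fun _ _ => rfl) j2
  have i3 : Integrable (fun x : E → ℝ => b * v * (1 - ∫ t, gibbsAvg (energy k s fun i =>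
      b * Function.update x e t i) (s e) ^ 2 ∂ν)) (Measure.pi fun _ : E => ν) :=
    ((integrable_const (1 : ℝ)).sub i2).const_mul (b * v)
  rw [h1, h2]
  have h3 : ∀ g : (E → ℝ) → ℝ, Integrable g (Measure.pi fun _ : E => ν) →
      b * v * (1 - ∫ x, g x ∂(Measure.pi fun _ : E => ν)) =
        ∫ x, b * v * (1 - g x) ∂(Measure.pi fun _ : E => ν) := fun g hg => by
    rw [integral_const_mul, integral_sub (integrable_const _) hg]; simp
  rw [h3 _ i2, ← integral_sub i1 i3]
  refine abs_integral_le_integral_abs.trans ?_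
  refine (integral_mono (i1.sub i3).abs
    (integrable_const (b ^ 2 * ρ + 2 * b ^ 2 * v * √v)) fun x => ?_).trans (by simp)
  obtain ⟨H, hH⟩ : ∃ H : S → ℝ, ∀ t, energy k s (fun i => b * Function.update x e t i) =
      fun σ => H σ + (b * t) * s e σ := ⟨_, fun t => energy_update k s x e t fun _ => b⟩
  simp only [Pi.sub_apply, hH, Function.update_self]
  exact hν.abs_integral_mul_sub_le hv hb (hasDerivAt_gibbsAvg_line H (s e) (hs e))
    fun t => abs_gibbsAvg_le _ fun σ => abs_le_one_of_sq (hs e σ)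

end Lindeberg

/-! ### Gaussian comparison -/

lemma integrable_id_gaussianReal (μ : ℝ) (v : NNReal) : Integrable id (gaussianReal μ v) :=
  memLp_one_iff_integrable.1 (memLp_id_gaussianReal 1)

/-- Gaussian integration by parts for bounded functions with bounded derivative. -/
lemma integral_mul_gaussianReal {f f' : ℝ → ℝ} (hf : ∀ t, HasDerivAt f (f' t) t)
    (hb : ∀ t, |f t| ≤ 1) (hf' : Measurable f') {C : ℝ} (hb' : ∀ t, |f' t| ≤ C) :
    ∫ t, t * f t ∂gaussianReal 0 1 = ∫ t, f' t ∂gaussianReal 0 1 := by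
  have hfm : Measurable f :=
    (continuous_iff_continuousAt.2 fun t => (hf t).continuousAt).measurable
  have hpdf : ∀ t, HasDerivAt (gaussianPDFReal 0 1) (-t * gaussianPDFReal 0 1 t) t := fun t => by
    have h1 : HasDerivAt (fun t : ℝ => -(t - 0) ^ 2 / (2 * ((1 : NNReal) : ℝ))) (-t) t := by
      have := (((hasDerivAt_id' t).sub_const 0).fun_pow 2).fun_neg.div_const
        (2 * ((1 : NNReal) : ℝ))
      refine this.congr_deriv ?_
      simp; ring
    have := h1.exp.const_mul (√(2 * Real.pi * ((1 : NNReal) : ℝ)))⁻¹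
    rw [gaussianPDFReal_def]
    refine this.congr_deriv ?_
    ring
  have hp0 := integrable_gaussianPDFReal 0 1
  have hp1 : Integrable (fun t => t * gaussianPDFReal 0 1 t) := by
    have := (integrable_mul_exp_neg_mul_sq (b := 1 / 2) (by norm_num)).const_mul
      (√(2 * Real.pi * ((1 : NNReal) : ℝ)))⁻¹
    refine this.congr (ae_of_all _ fun t => ?_)
    simp only [gaussianPDFReal]
    rw [show -(t - 0) ^ 2 / (2 * ((1 : NNReal) : ℝ)) = -(1 / 2) * t ^ 2 by simp; ring]
    ring
  have i1 : Integrable (f * fun t => -t * gaussianPDFReal 0 1 t) := by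
    refine Integrable.mono' hp1.abs (by
      have := measurable_gaussianPDFReal 0 1
      exact (hfm.mul (by fun_prop)).aestronglyMeasurable) (ae_of_all _ fun t => ?_)
    simp only [Pi.mul_apply, Real.norm_eq_abs, abs_mul, abs_neg]
    exact mul_le_of_le_one_left (by positivity) (hb t)
  have i2 : Integrable (f' * gaussianPDFReal 0 1) := by
    refine Integrable.mono' (hp0.const_mul C)
      (hf'.mul (measurable_gaussianPDFReal 0 1)).aestronglyMeasurable (ae_of_all _ fun t => ?_)
    simp only [Pi.mul_apply, Real.norm_eq_abs, abs_mul]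
    rw [abs_of_nonneg (gaussianPDFReal_nonneg 0 1 t)]
    exact mul_le_mul_of_nonneg_right (hb' t) (gaussianPDFReal_nonneg 0 1 t)
  have i3 : Integrable (f * gaussianPDFReal 0 1) := by
    refine Integrable.mono' hp0
      (hfm.mul (measurable_gaussianPDFReal 0 1)).aestronglyMeasurable (ae_of_all _ fun t => ?_)
    simp only [Pi.mul_apply, Real.norm_eq_abs, abs_mul]
    rw [abs_of_nonneg (gaussianPDFReal_nonneg 0 1 t)]
    exact mul_le_of_le_one_left (gaussianPDFReal_nonneg 0 1 t) (hb t)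
  have key := integral_mul_deriv_eq_deriv_mul_of_integrable (fun t _ => hf t) (fun t _ => hpdf t)
    i1 i2 i3
  rw [integral_gaussianReal_eq_integral_smul one_ne_zero,
    integral_gaussianReal_eq_integral_smul one_ne_zero]
  simp only [smul_eq_mul]
  have e1 : ∫ t, gaussianPDFReal 0 1 t * (t * f t) =
      -∫ t, f t * (-t * gaussianPDFReal 0 1 t) := by
    rw [← integral_neg]; congr 1; funext t; ring
  rw [e1, key, neg_neg]
  congr 1; funext t; ring

section Comparison

variable {S E : Type*} [Fintype S] [Nonempty S] [Fintype E]

/-- The expected free energy with independent Gaussian couplings of variance `v e`. -/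
def gaussFree (k : S → ℝ) (s : E → S → ℝ) (v : E → ℝ) : ℝ :=
  ∫ z, logSumExp (energy k s fun e => √(v e) * z e) ∂(Measure.pi fun _ : E => gaussianReal 0 1)

lemma integral_mul_gibbsAvg_gaussian (k : S → ℝ) {s : E → S → ℝ} (hs : ∀ e σ, s e σ ^ 2 = 1)
    (a : E → ℝ) (e : E) :
    ∫ z, z e * gibbsAvg (energy k s fun e => a e * z e) (s e)
        ∂(Measure.pi fun _ : E => gaussianReal 0 1) =
      a e * (1 - ∫ z, gibbsAvg (energy k s fun e => a e * z e) (s e) ^ 2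
        ∂(Measure.pi fun _ : E => gaussianReal 0 1)) := by
  classical
  have j1 := integrable_mul_gibbsAvg_energy k hs (fun _ : E => gaussianReal 0 1)
    (fun _ => integrable_id_gaussianReal 0 1) a e
  have j2 := integrable_gibbsAvg_energy k hs (fun _ : E => gaussianReal 0 1) a e 2
  have j3 : Integrable (fun x : E → ℝ => a e * (1 - gibbsAvg (energy k s fun e => a e * x e)
      (s e) ^ 2)) (Measure.pi fun _ : E => gaussianReal 0 1) :=
    ((integrable_const (1 : ℝ)).sub j2).const_mul (a e)
  have h3 : a e * (1 - ∫ z, gibbsAvg (energy k s fun e => a e * z e) (s e) ^ 2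
        ∂(Measure.pi fun _ : E => gaussianReal 0 1)) =
      ∫ z, a e * (1 - gibbsAvg (energy k s fun e => a e * z e) (s e) ^ 2)
        ∂(Measure.pi fun _ : E => gaussianReal 0 1) := by
    rw [integral_const_mul, integral_sub (integrable_const _) j2]; simp
  rw [h3, integral_pi_eq_integral_update (e := e) (fun _ _ => rfl) j1,
    integral_pi_eq_integral_update (e := e) (fun _ _ => rfl) j3]
  congr 1
  funext x
  obtain ⟨H, hH⟩ : ∃ H : S → ℝ, ∀ t, energy k s (fun i => a i * Function.update x e t i) =
      fun σ => H σ + (a e * t) * s e σ := ⟨_, fun t => energy_update k s x e t a⟩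
  simp only [hH, Function.update_self]
  have hT1 : ∀ t, |gibbsAvg (fun σ => H σ + t * s e σ) (s e)| ≤ 1 := fun t =>
    abs_gibbsAvg_le _ fun σ => abs_le_one_of_sq (hs e σ)
  have hT := hasDerivAt_gibbsAvg_line H (s e) (hs e)
  have hTc : Continuous fun t => gibbsAvg (fun σ => H σ + t * s e σ) (s e) :=
    continuous_iff_continuousAt.2 fun t => (hT t).continuousAt
  refine integral_mul_gaussianReal (C := |a e|)
    (f := fun t => gibbsAvg (fun σ => H σ + (a e * t) * s e σ) (s e)) (fun t => ?_)
    (fun t => hT1 _) ?_ fun t => ?_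
  · have := (hT (a e * t)).comp t ((hasDerivAt_id' t).const_mul (a e))
    refine this.congr_deriv ?_
    ring
  · have : Continuous fun t => gibbsAvg (fun σ => H σ + (a e * t) * s e σ) (s e) :=
      hTc.comp (continuous_const.mul continuous_id)
    exact (continuous_const.mul (continuous_const.sub (this.pow 2))).measurable
  · rw [abs_mul]
    exact mul_le_of_le_one_right (abs_nonneg _) (abs_one_sub_sq_le (hT1 _))

/-- Comparison of Gaussian free energies with ordered covariances. -/
lemma gaussFree_le_add (k : S → ℝ) {s : E → S → ℝ} (hs : ∀ e σ, s e σ ^ 2 = 1) {v w : E → ℝ}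
    (hv : ∀ e, 0 ≤ v e) (hw : ∀ e, 0 ≤ w e)
    (h : ∀ σ τ, 0 ≤ ∑ e, (w e - v e) * (s e σ * s e τ)) :
    gaussFree k s w ≤ gaussFree k s v + (∑ e, (w e - v e)) / 2 := by
  set γ : Measure (E → ℝ) := Measure.pi fun _ : E => gaussianReal 0 1 with hγ
  set c : ℝ → E → ℝ := fun u e => v e + u * (w e - v e) with hc
  set F : ℝ → (E → ℝ) → ℝ := fun u z => logSumExp (energy k s fun e => √(c u e) * z e) with hF
  set d : ℝ → E → ℝ := fun u e => (w e - v e) / (2 * √(c u e)) with hd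
  set F' : ℝ → (E → ℝ) → ℝ := fun u z =>
    ∑ e, d u e * (z e * gibbsAvg (energy k s fun e => √(c u e) * z e) (s e)) with hF'
  have hs1 : ∀ e σ, |s e σ| ≤ 1 := fun e σ => abs_le_one_of_sq (hs e σ)
  have hg1 : ∀ H e, |gibbsAvg H (s e)| ≤ 1 := fun H e => abs_gibbsAvg_le _ (hs1 e)
  have hid : ∀ _ : E, Integrable id (gaussianReal 0 1) := fun _ => integrable_id_gaussianReal 0 1
  have hc_lower : ∀ u r, r ≤ u → r ≤ 1 - u → ∀ e, r * (v e + w e) ≤ c u e := fun u r h1 h2 e => by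
    have := mul_le_mul_of_nonneg_right h1 (hw e)
    have := mul_le_mul_of_nonneg_right h2 (hv e)
    simp only [hc]; linarith
  have hc_upper : ∀ u ∈ Set.Icc (0 : ℝ) 1, ∀ e, c u e ≤ v e + w e := fun u hu e => by
    have := mul_le_mul_of_nonneg_right hu.2 (hw e)
    have := mul_nonneg hu.1 (hv e)
    simp only [hc]; linarith
  have hF_meas : ∀ u, AEStronglyMeasurable (F u) γ := fun u =>
    ((continuous_logSumExp_energy k s).comp (by fun_prop)).aestronglyMeasurable
  have hcont : ContinuousOn (fun u => ∫ z, F u z ∂γ) (Set.Icc 0 1) := by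
    refine continuousOn_of_dominated (bound := fun z => |logSumExp k| + ∑ e, √(v e + w e) * |z e|)
      (fun u _ => hF_meas u) (fun u hu => ae_of_all _ fun z => ?_)
      ((integrable_const _).add (integrable_sum_abs_pi _ hid _)) (ae_of_all _ fun z => ?_)
    · refine (abs_logSumExp_energy_le k hs1 _).trans ?_
      gcongr with e
      rw [abs_mul, abs_of_nonneg (Real.sqrt_nonneg _)]
      exact mul_le_mul_of_nonneg_right (Real.sqrt_le_sqrt (hc_upper u hu e)) (abs_nonneg _)
    · refine Continuous.continuousOn ((continuous_logSumExp_energy k s).comp ?_)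
      simp only [hc]; fun_prop
  have hderiv : ∀ u ∈ Set.Ioo (0 : ℝ) 1,
      HasDerivAt (fun u => ∫ z, F u z ∂γ) (∫ z, F' u z ∂γ) u := by
    intro u₀ hu₀
    obtain ⟨r, hr, hr1, hr2⟩ : ∃ r, 0 < r ∧ 2 * r ≤ u₀ ∧ 2 * r ≤ 1 - u₀ :=
      ⟨min u₀ (1 - u₀) / 2, by have := lt_min hu₀.1 (sub_pos.2 hu₀.2); linarith,
        by linarith [min_le_left u₀ (1 - u₀)], by linarith [min_le_right u₀ (1 - u₀)]⟩
    have hball : ∀ u ∈ Metric.ball u₀ r, r ≤ u ∧ r ≤ 1 - u := fun u hu => by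
      rw [Metric.mem_ball, Real.dist_eq, abs_lt] at hu
      constructor <;> linarith [hu.1, hu.2]
    have hvw : ∀ e, v e + w e = 0 → v e = 0 ∧ w e = 0 := fun e he =>
      ⟨by linarith [hv e, hw e], by linarith [hv e, hw e]⟩
    refine (hasDerivAt_integral_of_dominated_loc_of_deriv_le (F := F) (F' := F') (μ := γ)
      (bound := fun z => ∑ e, (v e + w e) / (2 * √(r * (v e + w e))) * |z e|)
      (Metric.ball_mem_nhds u₀ hr) (Eventually.of_forall hF_meas) ?_ ?_ (ae_of_all _ ?_)
      (integrable_sum_abs_pi _ hid _) (ae_of_all _ ?_)).2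
    · exact integrable_logSumExp_energy k hs _ hid _
    · refine Continuous.aestronglyMeasurable (continuous_finsetSum _ fun e _ => ?_)
      exact continuous_const.mul (Continuous.mul (by fun_prop)
        ((continuous_gibbsAvg_energy k s (s e)).comp (by fun_prop)))
    · intro z u hu
      rw [Real.norm_eq_abs]
      refine (Finset.abs_sum_le_sum_abs _ _).trans (Finset.sum_le_sum fun e _ => ?_)
      rw [abs_mul, abs_mul]
      have hz : |z e| * |gibbsAvg (energy k s fun e => √(c u e) * z e) (s e)| ≤ |z e| :=
        mul_le_of_le_one_right (abs_nonneg _) (hg1 _ e)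
      refine mul_le_mul ?_ hz (by positivity) (by have := hv e; have := hw e; positivity)
      rcases (add_nonneg (hv e) (hw e)).eq_or_lt with h0 | h0
      · obtain ⟨h1, h2⟩ := hvw e h0.symm
        simp [hd, h1, h2]
      · simp only [hd]
        rw [abs_div, abs_of_nonneg (by positivity : 0 ≤ 2 * √(c u e))]
        refine div_le_div₀ h0.le (abs_le.2 ⟨by linarith [hv e, hw e], by linarith [hv e, hw e]⟩)
          (by positivity) ?_
        have := Real.sqrt_le_sqrt (hc_lower u r (hball u hu).1 (hball u hu).2 e)
        linarith
    · intro z u hu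
      have hsq : ∀ e, HasDerivAt (fun u => √(c u e)) (d u e) u := fun e => by
        rcases (add_nonneg (hv e) (hw e)).eq_or_lt with h0 | h0
        · obtain ⟨h1, h2⟩ := hvw e h0.symm
          simp only [hc, hd, h1, h2]
          simpa using hasDerivAt_const u (0 : ℝ)
        · have hpos : 0 < c u e :=
            (mul_pos hr h0).trans_le (hc_lower u r (hball u hu).1 (hball u hu).2 e)
          have : HasDerivAt (fun u => c u e) (w e - v e) u :=
            (((hasDerivAt_id' u).mul_const (w e - v e)).const_add (v e)).congr_deriv (by ring)
          exact this.sqrt hpos.ne'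
      have := hasDerivAt_logSumExp (G := fun u => energy k s fun e => √(c u e) * z e)
        (G' := fun σ => ∑ e, (d u e * z e) * s e σ) (t := u) fun σ => by
          unfold energy
          exact (HasDerivAt.fun_sum fun e _ =>
            ((hsq e).mul_const (z e)).mul_const (s e σ)).const_add (k σ)
      refine this.congr_deriv ?_
      rw [gibbsAvg_sum]
      exact Finset.sum_congr rfl fun e _ => by ring
  have hbound : ∀ u ∈ Set.Ioo (0 : ℝ) 1, ∫ z, F' u z ∂γ ≤ (∑ e, (w e - v e)) / 2 := by
    intro u hu
    have j2 := fun e => integrable_gibbsAvg_energy k hs (fun _ : E => gaussianReal 0 1)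
      (fun e => √(c u e)) e 2
    have e1 : ∫ z, F' u z ∂γ = ∑ e, (w e - v e) / 2 *
        (1 - ∫ z, gibbsAvg (energy k s fun e => √(c u e) * z e) (s e) ^ 2 ∂γ) := by
      simp only [hF']
      rw [integral_finsetSum _ fun e _ => (integrable_mul_gibbsAvg_energy k hs _ hid
        (fun e => √(c u e)) e).const_mul (d u e)]
      refine Finset.sum_congr rfl fun e _ => ?_
      rw [integral_const_mul, integral_mul_gibbsAvg_gaussian k hs (fun e => √(c u e)) e,
        ← mul_assoc]
      congr 1
      simp only [hd]
      by_cases h0 : √(c u e) = 0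
      · have hm : 0 < min u (1 - u) := lt_min hu.1 (sub_pos.2 hu.2)
        have h1 := hc_lower u _ (min_le_left _ _) (min_le_right u (1 - u)) e
        have h2 := Real.sqrt_eq_zero'.1 h0
        have h3 : v e + w e ≤ 0 := by
          by_contra hcon
          have := mul_pos hm (not_le.1 hcon)
          linarith
        rw [h0, show v e = 0 by linarith [hv e, hw e], show w e = 0 by linarith [hv e, hw e]]
        simp
      · field_simp
    have e2 : 0 ≤ ∫ z, ∑ e, (w e - v e) *
        gibbsAvg (energy k s fun e => √(c u e) * z e) (s e) ^ 2 ∂γ :=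
      integral_nonneg fun z => gibbsAvg_sq_form_nonneg _ _ s h
    rw [integral_finsetSum _ fun e _ => (j2 e).const_mul _] at e2
    simp only [integral_const_mul] at e2
    rw [e1, Finset.sum_div]
    have : ∑ e, (w e - v e) / 2 *
        (1 - ∫ z, gibbsAvg (energy k s fun e => √(c u e) * z e) (s e) ^ 2 ∂γ) =
        ∑ e, (w e - v e) / 2 - (∑ e, (w e - v e) *
          ∫ z, gibbsAvg (energy k s fun e => √(c u e) * z e) (s e) ^ 2 ∂γ) / 2 := by
      rw [Finset.sum_div, ← Finset.sum_sub_distrib]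
      exact Finset.sum_congr rfl fun e _ => by ring
    linarith
  have := (convex_Icc (0 : ℝ) 1).image_sub_le_mul_sub_of_deriv_le hcont
    (by rw [interior_Icc]; exact fun u hu => (hderiv u hu).differentiableAt.differentiableWithinAt)
    (by rw [interior_Icc]; exact fun u hu => (hderiv u hu).deriv.trans_le (hbound u hu))
    0 (by simp) 1 (by simp) zero_le_one
  have h0 : ∫ z, F 0 z ∂γ = gaussFree k s v := by simp [hF, hc, gaussFree, hγ]
  have h1 : ∫ z, F 1 z ∂γ = gaussFree k s w := by simp [hF, hc, gaussFree, hγ]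
  linarith

end Comparison

/-! ### The free energy in the inverse temperature -/

section Subgradient

variable {S E : Type*} [Fintype S] [Nonempty S] [Fintype E]

/-- The slope of the expected free energy at inverse temperature `b`. -/
def freeSlope (k : S → ℝ) (s : E → S → ℝ) (ν : Measure ℝ) (b : ℝ) : ℝ :=
  ∑ e, ∫ x, x e * gibbsAvg (energy k s fun e => b * x e) (s e) ∂(Measure.pi fun _ : E => ν)

lemma freeSlope_mul_le (k : S → ℝ) {s : E → S → ℝ} (hs : ∀ e σ, s e σ ^ 2 = 1) {ν : Measure ℝ}
    [IsProbabilityMeasure ν] (hν : Integrable id ν) (b b' : ℝ) :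
    (b' - b) * freeSlope k s ν b ≤
      ∫ x, logSumExp (energy k s fun e => b' * x e) ∂(Measure.pi fun _ : E => ν) -
      ∫ x, logSumExp (energy k s fun e => b * x e) ∂(Measure.pi fun _ : E => ν) := by
  have hF := fun b : ℝ => integrable_logSumExp_energy k hs (fun _ : E => ν) (fun _ => hν)
    fun _ => b
  have hM := fun e => integrable_mul_gibbsAvg_energy k hs (fun _ : E => ν) (fun _ => hν)
    (fun _ => b) e
  rw [freeSlope, ← integral_finsetSum _ fun e _ => hM e, ← integral_const_mul,
    ← integral_sub (hF b') (hF b)]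
  refine integral_mono ((integrable_finsetSum _ fun e _ => hM e).const_mul _)
    ((hF b').sub (hF b)) fun x => ?_
  have h1 := gibbsAvg_sub_le (energy k s fun e => b * x e) (energy k s fun e => b' * x e)
  have h2 : (fun σ => energy k s (fun e => b' * x e) σ - energy k s (fun e => b * x e) σ) =
      fun σ => ∑ e, ((b' - b) * x e) * s e σ := by
    funext σ
    simp only [energy, add_sub_add_left_eq_sub, ← Finset.sum_sub_distrib]
    exact Finset.sum_congr rfl fun e _ => by ring
  rw [h2, gibbsAvg_sum] at h1
  refine le_trans (le_of_eq ?_) h1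
  rw [Finset.mul_sum]
  exact Finset.sum_congr rfl fun e _ => by ring

lemma gaussFree_const_mono (k : S → ℝ) {s : E → S → ℝ} (hs : ∀ e σ, s e σ ^ 2 = 1) {t t' : ℝ}
    (h : t ≤ t') : gaussFree k s (fun _ => t) ≤ gaussFree k s fun _ => t' := by
  have h1 := freeSlope_mul_le k hs (integrable_id_gaussianReal 0 1) (√t) (√t')
  have h2 : 0 ≤ freeSlope k s (gaussianReal 0 1) (√t) := by
    refine Finset.sum_nonneg fun e _ => ?_
    rw [integral_mul_gibbsAvg_gaussian k hs (fun _ => √t) e]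
    refine mul_nonneg (Real.sqrt_nonneg _) (sub_nonneg.2 ?_)
    have hInt := integrable_gibbsAvg_energy k hs (fun _ : E => gaussianReal 0 1) (fun _ => √t) e 2
    refine (integral_mono hInt (integrable_const 1) fun z => ?_).trans (by simp)
    rw [← sq_abs]
    exact pow_le_one₀ (abs_nonneg _) (abs_gibbsAvg_le _ fun σ => abs_le_one_of_sq (hs e σ))
  have h3 := mul_nonneg (sub_nonneg.2 (Real.sqrt_le_sqrt h)) h2
  unfold gaussFree
  linarith

end Subgradient

/-! ### The Sherrington–Kirkpatrick pressure -/

lemma spin_sq (b : Bool) : spin b ^ 2 = 1 := by cases b <;> simp [spin]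

/-- The interaction of a pair of spins. -/
def pairSpin {V : Type*} (e : V × V) (σ : V → Bool) : ℝ := spin (σ e.1) * spin (σ e.2)

lemma pairSpin_sq {V : Type*} (e : V × V) (σ : V → Bool) : pairSpin e σ ^ 2 = 1 := by
  simp [pairSpin, mul_pow, spin_sq]

lemma sum_pairSpin_mul {V : Type*} [Fintype V] (σ τ : V → Bool) :
    ∑ e : V × V, pairSpin e σ * pairSpin e τ = (∑ i, spin (σ i) * spin (τ i)) ^ 2 := by
  rw [sq, Finset.sum_mul_sum, Fintype.sum_prod_type]
  refine Finset.sum_congr rfl fun i _ => Finset.sum_congr rfl fun j _ => ?_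
  simp only [pairSpin]; ring

/-- The Sherrington–Kirkpatrick pressure at squared inverse temperature `t`. -/
def skPressure (V : Type*) [Fintype V] [DecidableEq V] (t : ℝ) : ℝ :=
  gaussFree (fun _ : V → Bool => 0) pairSpin fun _ => t / (2 * Fintype.card V)

lemma integral_comp_pi {E E' : Type*} [Fintype E] [Fintype E'] {μ : Measure ℝ}
    [IsProbabilityMeasure μ] {f : E' → E} (hf : Function.Injective f) {F : (E' → ℝ) → ℝ}
    (hF : Continuous F) :
    ∫ x, F (x ∘ f) ∂(Measure.pi fun _ : E => μ) = ∫ x, F x ∂(Measure.pi fun _ : E' => μ) := by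
  have hp := measurePreserving_comp_pi μ hf
  rw [← hp.map_eq, integral_map hp.measurable.aemeasurable hF.aestronglyMeasurable]

lemma logSumExp_add_prod {S S' : Type*} [Fintype S] [Nonempty S] [Fintype S'] [Nonempty S']
    (H : S → ℝ) (H' : S' → ℝ) :
    logSumExp (fun p : S × S' => H p.1 + H' p.2) = logSumExp H + logSumExp H' := by
  unfold logSumExp
  rw [← Real.log_mul (sum_exp_pos H).ne' (sum_exp_pos H').ne', Finset.sum_mul_sum,
    Fintype.sum_prod_type]
  simp only [Real.exp_add]

lemma logSumExp_comp_equiv {S S' : Type*} [Fintype S] [Fintype S'] (φ : S ≃ S') (H : S' → ℝ) :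
    logSumExp (fun σ => H (φ σ)) = logSumExp H := by
  unfold logSumExp
  rw [Equiv.sum_comp φ fun σ => Real.exp (H σ)]

lemma skPressure_congr {V W : Type*} [Fintype V] [Fintype W] [DecidableEq V] [DecidableEq W]
    (φ : V ≃ W) (t : ℝ) :
    skPressure V t = skPressure W t := by
  unfold skPressure gaussFree
  have hc : Continuous fun z : V × V → ℝ => logSumExp (energy (fun _ : V → Bool => 0) pairSpin
      fun e => √(t / (2 * Fintype.card V)) * z e) :=
    (continuous_logSumExp_energy _ _).comp (by fun_prop)
  rw [← integral_comp_pi (φ.prodCongr φ).injective hc]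
  congr 1
  funext z
  rw [← logSumExp_comp_equiv (φ.arrowCongr (Equiv.refl Bool))]
  congr 1
  funext σ
  simp only [energy, Fintype.card_congr φ]
  rw [← Equiv.sum_comp (φ.prodCongr φ)]
  simp [pairSpin]

lemma skPressure_fin_zero (t : ℝ) : skPressure (Fin 0) t = 0 := by
  simp [skPressure, gaussFree, logSumExp, energy]

/-- Guerra–Toninelli interpolation between a system and two subsystems at
different temperatures. -/
lemma skPressure_add_le {V W : Type*} [Fintype V] [Fintype W] [DecidableEq V]
    [DecidableEq W] [Nonempty V] [Nonempty W]
    {a b T : ℝ} (ha : 0 < a) (hb : 0 < b) (hT : 0 < T)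
    (h : (Fintype.card V : ℝ) / a + Fintype.card W / b ≤ (Fintype.card V + Fintype.card W) / T) :
    skPressure V a + skPressure W b ≤ skPressure (V ⊕ W) T +
      (Fintype.card V * a + Fintype.card W * b - (Fintype.card V + Fintype.card W) * T) / 4 := by
  set N : ℝ := (Fintype.card V : ℝ) with hN
  set M : ℝ := (Fintype.card W : ℝ) with hM
  have hN0 : 0 < N := by simp [hN, Fintype.card_pos]
  have hM0 : 0 < M := by simp [hM, Fintype.card_pos]
  set w : (V ⊕ W) × (V ⊕ W) → ℝ := fun e =>
    match e with
    | (Sum.inl _, Sum.inl _) => a / (2 * N)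
    | (Sum.inr _, Sum.inr _) => b / (2 * M)
    | _ => 0 with hw
  have hsplit : gaussFree (fun _ : V ⊕ W → Bool => 0) pairSpin w =
      skPressure V a + skPressure W b := by
    have c1 : Continuous fun z : V × V → ℝ => logSumExp (energy (fun _ : V → Bool => 0) pairSpin
        fun e => √(a / (2 * N)) * z e) := (continuous_logSumExp_energy _ _).comp (by fun_prop)
    have c2 : Continuous fun z : W × W → ℝ => logSumExp (energy (fun _ : W → Bool => 0) pairSpin
        fun e => √(b / (2 * M)) * z e) := (continuous_logSumExp_energy _ _).comp (by fun_prop)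
    have f1 : Function.Injective (Prod.map Sum.inl Sum.inl : V × V → (V ⊕ W) × (V ⊕ W)) :=
      Sum.inl_injective.prodMap Sum.inl_injective
    have f2 : Function.Injective (Prod.map Sum.inr Sum.inr : W × W → (V ⊕ W) × (V ⊕ W)) :=
      Sum.inr_injective.prodMap Sum.inr_injective
    have i1 := (measurePreserving_comp_pi (gaussianReal 0 1) f1).integrable_comp_of_integrable
      (integrable_logSumExp_energy (fun _ : V → Bool => 0) (pairSpin_sq (V := V))
        (fun _ => gaussianReal 0 1) (fun _ => integrable_id_gaussianReal 0 1)
        fun _ => √(a / (2 * N)))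
    have i2 := (measurePreserving_comp_pi (gaussianReal 0 1) f2).integrable_comp_of_integrable
      (integrable_logSumExp_energy (fun _ : W → Bool => 0) (pairSpin_sq (V := W))
        (fun _ => gaussianReal 0 1) (fun _ => integrable_id_gaussianReal 0 1)
        fun _ => √(b / (2 * M)))
    unfold skPressure gaussFree
    rw [← integral_comp_pi f1 c1, ← integral_comp_pi f2 c2]
    refine Eq.trans ?_ (integral_add i1 i2)
    congr 1
    funext z
    simp only [Function.comp_def]
    rw [← logSumExp_add_prod,
      ← logSumExp_comp_equiv (Equiv.sumArrowEquivProdArrow V W Bool)]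
    congr 1
    funext σ
    simp only [energy, Fintype.sum_prod_type, Fintype.sum_sum_type, zero_add]
    simp [hw, pairSpin]
  have hsum : ∀ f : (V ⊕ W) × (V ⊕ W) → ℝ, ∑ e, w e * f e =
      a / (2 * N) * ∑ e : V × V, f (Sum.inl e.1, Sum.inl e.2) +
      b / (2 * M) * ∑ e : W × W, f (Sum.inr e.1, Sum.inr e.2) := fun f => by
    simp [hw, Fintype.sum_prod_type, Fintype.sum_sum_type, Finset.sum_add_distrib, Finset.mul_sum]
  have hform : ∀ σ τ : V ⊕ W → Bool, 0 ≤ ∑ e, (w e - T / (2 * (N + M))) *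
      (pairSpin e σ * pairSpin e τ) := fun σ τ => by
    simp only [sub_mul, Finset.sum_sub_distrib]
    rw [hsum, ← Finset.mul_sum, sum_pairSpin_mul, Fintype.sum_sum_type]
    have h1 := sum_pairSpin_mul (σ ∘ Sum.inl) (τ ∘ Sum.inl : V → Bool)
    have h2 := sum_pairSpin_mul (σ ∘ Sum.inr) (τ ∘ Sum.inr : W → Bool)
    simp only [pairSpin, Function.comp_apply] at h1 h2 ⊢
    rw [h1, h2]
    set X := ∑ i : V, spin (σ (Sum.inl i)) * spin (τ (Sum.inl i))
    set Y := ∑ i : W, spin (σ (Sum.inr i)) * spin (τ (Sum.inr i))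
    have hQ : 0 ≤ a / N * X ^ 2 + b / M * Y ^ 2 := by positivity
    have hcs : (X + Y) ^ 2 ≤ (a / N * X ^ 2 + b / M * Y ^ 2) * (N / a + M / b) := by
      have : (a / N * X ^ 2 + b / M * Y ^ 2) * (N / a + M / b) - (X + Y) ^ 2 =
          (a * M * X - b * N * Y) ^ 2 / (a * b * N * M) := by
        field_simp; ring
      have h0 : 0 ≤ (a * M * X - b * N * Y) ^ 2 / (a * b * N * M) := by positivity
      linarith
    have h3 := hcs.trans (mul_le_mul_of_nonneg_left h hQ)
    have h4 : T / (2 * (N + M)) * (X + Y) ^ 2 ≤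
        T / (2 * (N + M)) * ((a / N * X ^ 2 + b / M * Y ^ 2) * ((N + M) / T)) :=
      mul_le_mul_of_nonneg_left h3 (by positivity)
    have h5 : T / (2 * (N + M)) * ((a / N * X ^ 2 + b / M * Y ^ 2) * ((N + M) / T)) =
        a / (2 * N) * X ^ 2 + b / (2 * M) * Y ^ 2 := by field_simp
    linarith
  have hcard : ((Fintype.card (V ⊕ W) : ℕ) : ℝ) = N + M := by simp [hN, hM]
  have key := gaussFree_le_add (fun _ : V ⊕ W → Bool => 0) pairSpin_sq
    (v := fun _ => T / (2 * (N + M))) (w := w) (fun _ => by positivity)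
    (fun e => by rcases e with ⟨_ | _, _ | _⟩ <;> simp only [hw] <;> positivity) hform
  rw [hsplit] at key
  have htot : ∑ e, (w e - T / (2 * (N + M))) = (N * a + M * b - (N + M) * T) / 2 := by
    have := hsum fun _ => 1
    simp only [mul_one] at this
    rw [Finset.sum_sub_distrib, this]
    simp only [Finset.sum_const, Finset.card_univ, Fintype.card_prod, nsmul_eq_mul, mul_one,
      Nat.cast_mul, hcard, ← hN, ← hM]
    field_simp
  rw [htot] at key
  unfold skPressure at key ⊢
  rw [hcard]
  linarith

/-! ### The limiting pressure and its differentiability -/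

lemma skPressure_fin_le (n : ℕ) {t : ℝ} (ht : 0 ≤ t) :
    skPressure (Fin n) t ≤ n * (Real.log 2 + t / 4) := by
  rcases Nat.eq_zero_or_pos n with rfl | hn
  · simp [skPressure_fin_zero]
  have hn0 : (0 : ℝ) < n := by exact_mod_cast hn
  have h1 := gaussFree_le_add (fun _ : Fin n → Bool => 0) (s := pairSpin) pairSpin_sq
    (v := fun _ => 0) (w := fun _ => t / (2 * n)) (fun _ => le_rfl) (fun _ => by positivity)
    fun σ τ => by
      simp only [sub_zero, ← Finset.mul_sum, sum_pairSpin_mul]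
      positivity
  have h2 : gaussFree (fun _ : Fin n → Bool => 0) pairSpin (fun _ => 0) = n * Real.log 2 := by
    simp [gaussFree, logSumExp, energy]
  have h3 : ∑ _e : Fin n × Fin n, (t / (2 * (n : ℝ)) - 0) = n * t / 2 := by
    simp only [sub_zero, Finset.sum_const, Finset.card_univ, Fintype.card_prod, Fintype.card_fin,
      nsmul_eq_mul, Nat.cast_mul]
    field_simp
  rw [h2, h3] at h1
  simp only [skPressure, Fintype.card_fin]
  linarith

lemma skPressure_fin_add_le {m n : ℕ} (hm : 0 < m) (hn : 0 < n) {a b T : ℝ} (ha : 0 < a)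
    (hb : 0 < b) (hT : 0 < T) (h : (m : ℝ) / a + n / b ≤ (m + n) / T) :
    skPressure (Fin m) a + skPressure (Fin n) b ≤ skPressure (Fin (m + n)) T +
      (m * a + n * b - (m + n) * T) / 4 := by
  have : Nonempty (Fin m) := ⟨⟨0, hm⟩⟩
  have : Nonempty (Fin n) := ⟨⟨0, hn⟩⟩
  have := skPressure_add_le (V := Fin m) (W := Fin n) ha hb hT (by simpa using h)
  rw [skPressure_congr finSumFinEquiv] at this
  simpa using this

lemma exists_tendsto_skPressure {t : ℝ} (ht : 0 < t) :
    ∃ p, Tendsto (fun n : ℕ => skPressure (Fin n) t / n) atTop (nhds p) := by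
  have hsub : Subadditive fun n => -skPressure (Fin n) t := by
    intro m n
    rcases Nat.eq_zero_or_pos m with rfl | hm
    · simpa [skPressure_fin_zero] using
        (skPressure_congr (finCongr (Nat.zero_add n).symm) t).le
    rcases Nat.eq_zero_or_pos n with rfl | hn
    · simp [skPressure_fin_zero]
    have := skPressure_fin_add_le hm hn ht ht ht (by rw [← add_div])
    simp only
    linarith
  have hbdd : BddBelow (Set.range fun n : ℕ => -skPressure (Fin n) t / n) := by
    refine ⟨-(Real.log 2 + t / 4), ?_⟩
    rintro _ ⟨n, rfl⟩
    simp only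
    rcases Nat.eq_zero_or_pos n with rfl | hn
    · have := Real.log_pos one_lt_two
      simp; linarith
    have hn0 : (0 : ℝ) < n := by exact_mod_cast hn
    rw [le_div_iff₀ hn0]
    have := skPressure_fin_le n ht.le
    linarith
  refine ⟨-hsub.lim, ?_⟩
  refine (hsub.tendsto_lim hbdd).neg.congr fun n => ?_
  ring

/-- The limit of the pressure per spin at inverse temperature `b`. -/
def limPressure (b : ℝ) : ℝ := limUnder atTop fun n : ℕ => skPressure (Fin n) (b ^ 2) / n

lemma tendsto_limPressure {b : ℝ} (hb : 0 < b) :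
    Tendsto (fun n : ℕ => skPressure (Fin n) (b ^ 2) / n) atTop (nhds (limPressure b)) :=
  tendsto_nhds_limUnder (exists_tendsto_skPressure (by positivity))

lemma limPressure_mono {b b' : ℝ} (hb : 0 < b) (h : b ≤ b') : limPressure b ≤ limPressure b' := by
  refine le_of_tendsto_of_tendsto' (tendsto_limPressure hb)
    (tendsto_limPressure (hb.trans_le h)) fun n => ?_
  refine div_le_div_of_nonneg_right ?_ (Nat.cast_nonneg n)
  unfold skPressure
  exact gaussFree_const_mono _ pairSpin_sq (by gcongr)

lemma limPressure_add_le {b₁ b₂ β : ℝ} (h₁ : 0 < b₁) (h₂ : 0 < b₂) (hβ : 0 < β)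
    (h : 1 / b₁ ^ 2 + 1 / b₂ ^ 2 ≤ 2 / β ^ 2) :
    limPressure b₁ + limPressure b₂ ≤
      2 * limPressure β + (b₁ ^ 2 + b₂ ^ 2 - 2 * β ^ 2) / 4 := by
  have hdouble : Tendsto (fun n : ℕ => n + n) atTop atTop :=
    tendsto_atTop_mono (fun n => Nat.le_add_left n n) tendsto_id
  refine le_of_tendsto_of_tendsto ((tendsto_limPressure h₁).add (tendsto_limPressure h₂))
    ((((tendsto_limPressure hβ).comp hdouble).const_mul 2).add_const _) ?_
  filter_upwards [eventually_gt_atTop 0] with n hn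
  have hn0 : (0 : ℝ) < n := by exact_mod_cast hn
  have key := skPressure_fin_add_le hn hn (sq_pos_of_pos h₁) (sq_pos_of_pos h₂)
    (sq_pos_of_pos hβ) (by
      have := mul_le_mul_of_nonneg_left h hn0.le
      calc (n : ℝ) / b₁ ^ 2 + n / b₂ ^ 2 = n * (1 / b₁ ^ 2 + 1 / b₂ ^ 2) := by ring
        _ ≤ n * (2 / β ^ 2) := this
        _ = _ := by ring)
  have := div_le_div_of_nonneg_right key hn0.le
  simp only [Function.comp_apply]
  push_cast
  calc _ = (skPressure (Fin n) (b₁ ^ 2) + skPressure (Fin n) (b₂ ^ 2)) / n := by ring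
    _ ≤ _ := this
    _ = _ := by field_simp; ring

/-- The limiting pressure has arbitrarily close left and right secant slopes. -/
lemma exists_secants_limPressure {β ε : ℝ} (hβ : 0 < β) (hε : 0 < ε) :
    ∃ b₁ b₂, 0 < b₁ ∧ b₁ < β ∧ β < b₂ ∧
      (limPressure b₂ - limPressure β) / (b₂ - β) ≤
        (limPressure β - limPressure b₁) / (β - b₁) + ε := by
  obtain ⟨η, hη, hη1, hη2⟩ : ∃ η : ℝ, 0 < η ∧ η ≤ 1 / 8 ∧ β * η * 3 ≤ ε := by
    refine ⟨min (1 / 8) (ε / (β * 3)), lt_min (by norm_num) (by positivity), min_le_left _ _, ?_⟩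
    have h1 := min_le_right (1 / 8) (ε / (β * 3))
    have h2 := mul_le_mul_of_nonneg_left h1 (by positivity : 0 ≤ β * 3)
    have h3 : β * 3 * (ε / (β * 3)) = ε := by field_simp
    linarith
  set θ := η - 4 * η ^ 2 with hθ
  have hθ0 : 0 < θ := by rw [hθ]; nlinarith
  have hθη : θ ≤ η := by rw [hθ]; nlinarith
  have hsum : 1 / (β * (1 + η)) ^ 2 + 1 / (β * (1 - θ)) ^ 2 ≤ 2 / β ^ 2 := by
    have e1 : 1 / (1 + η) ^ 2 ≤ 1 - 2 * η + 3 * η ^ 2 := by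
      rw [div_le_iff₀ (by positivity)]
      have : 0 ≤ 4 * η ^ 3 + 3 * η ^ 4 := by positivity
      nlinarith
    have e2 : 1 / (1 - θ) ^ 2 ≤ 1 + 2 * θ + 4 * θ ^ 2 := by
      have h1 : 0 < 1 - θ := by linarith
      rw [div_le_iff₀ (by positivity)]
      have : 0 ≤ θ ^ 2 * (1 - 6 * θ + 4 * θ ^ 2) := by
        have : 0 ≤ 1 - 6 * θ + 4 * θ ^ 2 := by nlinarith
        positivity
      nlinarith
    have e3 : 1 / (1 + η) ^ 2 + 1 / (1 - θ) ^ 2 ≤ 2 := by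
      have : θ ^ 2 ≤ η ^ 2 := by gcongr
      nlinarith
    calc _ = (1 / (1 + η) ^ 2 + 1 / (1 - θ) ^ 2) / β ^ 2 := by
          rw [mul_pow, mul_pow]; field_simp
      _ ≤ _ := by gcongr
  have key := limPressure_add_le (b₁ := β * (1 + η)) (b₂ := β * (1 - θ)) (by positivity)
    (mul_pos hβ (by linarith)) hβ hsum
  have hmono : limPressure (β * (1 - θ)) ≤ limPressure β :=
    limPressure_mono (mul_pos hβ (by linarith)) (by nlinarith)
  refine ⟨β * (1 - θ), β * (1 + η), mul_pos hβ (by linarith), by nlinarith, by nlinarith, ?_⟩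
  have e1 : β * (1 + η) - β = β * η := by ring
  have e2 : β - β * (1 - θ) = β * θ := by ring
  rw [e1, e2]
  have hcost : ((β * (1 + η)) ^ 2 + (β * (1 - θ)) ^ 2 - 2 * β ^ 2) / 4 ≤ ε * (β * η) := by
    have h1 : (β * (1 + η)) ^ 2 + (β * (1 - θ)) ^ 2 - 2 * β ^ 2 =
        β ^ 2 * (9 * η ^ 2 + θ ^ 2) := by rw [hθ]; ring
    have h2 : θ ^ 2 ≤ η ^ 2 := by gcongr
    have h3 : β ^ 2 * (9 * η ^ 2 + θ ^ 2) ≤ β ^ 2 * (10 * η ^ 2) := by gcongr; linarith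
    have h4 := mul_le_mul_of_nonneg_right hη2 (by positivity : 0 ≤ β * η)
    have h5 : 0 ≤ β ^ 2 * η ^ 2 := by positivity
    nlinarith
  calc (limPressure (β * (1 + η)) - limPressure β) / (β * η)
      ≤ (limPressure β - limPressure (β * (1 - θ)) + ε * (β * η)) / (β * η) := by
        gcongr; linarith
    _ = (limPressure β - limPressure (β * (1 - θ))) / (β * η) + ε := by field_simp
    _ ≤ _ := by
        gcongr

/-! ### Centred Gaussian and Poisson laws -/

section Laws

open scoped NNReal

/-- The third absolute moment of a standard Gaussian variable. -/
def gaussianThirdMoment : ℝ := ∫ z, |z| ^ 3 ∂(gaussianReal 0 1)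

lemma gaussianThirdMoment_nonneg : 0 ≤ gaussianThirdMoment :=
  integral_nonneg fun _ => by positivity

lemma integrable_abs_cube_gaussianReal (v : ℝ≥0) :
    Integrable (fun z => |z| ^ 3) (gaussianReal 0 v) := by
  have h := (memLp_id_gaussianReal (μ := 0) (v := v) 3).integrable_norm_pow (by norm_num)
  simpa using h

lemma measurePreserving_sqrt_mul_gaussianReal (v : ℝ≥0) :
    MeasurePreserving (fun z : ℝ => √(v : ℝ) * z) (gaussianReal 0 1) (gaussianReal 0 v) := by
  refine ⟨by fun_prop, ?_⟩
  rw [gaussianReal_map_const_mul]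
  congr 1
  · simp
  · ext
    simp

lemma measurePreserving_neg_gaussianReal (v : ℝ≥0) :
    MeasurePreserving (fun z : ℝ => -z) (gaussianReal 0 v) (gaussianReal 0 v) := by
  refine ⟨by fun_prop, ?_⟩
  rw [gaussianReal_map_neg, neg_zero]

lemma isCenteredLaw_gaussianReal (v : ℝ≥0) :
    IsCenteredLaw (gaussianReal 0 v) v (√(v : ℝ) ^ 3 * gaussianThirdMoment) where
  isProb := inferInstance
  integrable_cube := integrable_abs_cube_gaussianReal v
  mean := integral_id_gaussianReal
  var := by
    have h := variance_fun_id_gaussianReal (μ := 0) (v := v)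
    rw [variance_of_integral_eq_zero (by fun_prop) integral_id_gaussianReal] at h
    simpa using h
  third := by
    rw [← (measurePreserving_sqrt_mul_gaussianReal v).map_eq, integral_map (by fun_prop)
      (by fun_prop), gaussianThirdMoment, ← integral_const_mul]
    refine le_of_eq (integral_congr_ae (ae_of_all _ fun z => ?_))
    simp only [abs_mul, abs_of_nonneg (Real.sqrt_nonneg _), mul_pow]

/-- The Chen–Stein identity. -/
lemma integral_mul_poissonMeasure (r : ℝ≥0) {f : ℕ → ℝ}
    (hf : Integrable (fun k => f (k + 1)) (poissonMeasure r)) :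
    Integrable (fun k : ℕ => (k : ℝ) * f k) (poissonMeasure r) ∧
      ∫ k, (k : ℝ) * f k ∂(poissonMeasure r) = r * ∫ k, f (k + 1) ∂(poissonMeasure r) := by
  have hw : ∀ k : ℕ, Real.exp (-r) * (r : ℝ) ^ (k + 1) / (k + 1).factorial * ((k + 1 : ℕ) : ℝ) =
      r * (Real.exp (-r) * (r : ℝ) ^ k / k.factorial) := fun k => by
    have : ((k + 1 : ℕ) : ℝ) ≠ 0 := by positivity
    have : (k.factorial : ℝ) ≠ 0 := by positivity
    rw [Nat.factorial_succ]
    push_cast at *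
    field_simp
    ring
  have hi : Integrable (fun k : ℕ => (k : ℝ) * f k) (poissonMeasure r) := by
    rw [integrable_poissonMeasure_iff] at hf ⊢
    rw [← summable_nat_add_iff 1]
    refine (hf.mul_left (r : ℝ)).congr fun k => ?_
    rw [norm_mul, ← mul_assoc, ← mul_assoc, ← hw, Real.norm_natCast]
  refine ⟨hi, ?_⟩
  have h1 := hasSum_integral_poissonMeasure hi
  have h2 := (hasSum_integral_poissonMeasure hf).mul_left (r : ℝ)
  rw [← hasSum_nat_add_iff' 1] at h1
  simp only [Finset.range_one, Finset.sum_singleton, Nat.cast_zero, zero_mul, smul_zero,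
    sub_zero] at h1
  have he : ∀ k : ℕ, (Real.exp (-r) * (r : ℝ) ^ (k + 1) / (k + 1).factorial) •
      (((k + 1 : ℕ) : ℝ) * f (k + 1)) =
      r * (Real.exp (-r) * (r : ℝ) ^ k / k.factorial) • f (k + 1) := fun k => by
    rw [smul_eq_mul, smul_eq_mul, ← mul_assoc, ← mul_assoc, ← hw]
  simp only [he] at h1
  exact h1.unique h2

lemma integral_pow_poissonMeasure (r : ℝ≥0) :
    (Integrable (fun k : ℕ => (k : ℝ)) (poissonMeasure r) ∧
      ∫ k : ℕ, (k : ℝ) ∂(poissonMeasure r) = r) ∧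
    (Integrable (fun k : ℕ => (k : ℝ) ^ 2) (poissonMeasure r) ∧
      ∫ k : ℕ, (k : ℝ) ^ 2 ∂(poissonMeasure r) = r ^ 2 + r) ∧
    (Integrable (fun k : ℕ => (k : ℝ) ^ 3) (poissonMeasure r) ∧
      ∫ k : ℕ, (k : ℝ) ^ 3 ∂(poissonMeasure r) = r ^ 3 + 3 * r ^ 2 + r) := by
  have i0 : Integrable (fun _ : ℕ => (1 : ℝ)) (poissonMeasure r) := integrable_const _
  obtain ⟨i1, e1⟩ := integral_mul_poissonMeasure r (f := fun _ => 1) i0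
  simp only [mul_one, integral_const, probReal_univ, one_smul] at i1 e1
  have j1 : Integrable (fun k : ℕ => (k : ℝ) + 1) (poissonMeasure r) := i1.add i0
  obtain ⟨i2, e2⟩ := integral_mul_poissonMeasure r (f := fun k => (k : ℝ)) (by simpa using j1)
  simp only [Nat.cast_add, Nat.cast_one] at e2
  rw [integral_add i1 i0] at e2
  have j2 : Integrable (fun k : ℕ => (k : ℝ) * k + 2 * k + 1) (poissonMeasure r) :=
    (i2.add (i1.const_mul 2)).add i0
  have hsq : ∀ k : ℕ, ((k + 1 : ℕ) : ℝ) ^ 2 = k * k + 2 * k + 1 := fun k => by push_cast; ring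
  obtain ⟨i3, e3⟩ := integral_mul_poissonMeasure r (f := fun k => (k : ℝ) ^ 2)
    (by simpa only [hsq] using j2)
  simp only [hsq] at e3
  have j3 : Integrable (fun k : ℕ => (k : ℝ) * k + 2 * k) (poissonMeasure r) :=
    i2.add (i1.const_mul 2)
  rw [integral_add j3 i0, integral_add i2 (i1.const_mul 2), integral_const_mul] at e3
  have p2 : ∀ k : ℕ, (k : ℝ) ^ 2 = k * k := fun k => by ring
  have p3 : ∀ k : ℕ, (k : ℝ) ^ 3 = k * k ^ 2 := fun k => by ring
  refine ⟨⟨i1, e1⟩, ⟨?_, ?_⟩, ?_, ?_⟩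
  · simpa only [p2] using i2
  · simp only [p2, e2, e1, integral_const, probReal_univ, one_smul]; ring
  · simpa only [p3] using i3
  · simp only [p3, e3, e2, e1, integral_const, probReal_univ, one_smul]; ring

lemma abs_sub_cube_le {a b : ℝ} (ha : 0 ≤ a) (hb : 0 ≤ b) : |a - b| ^ 3 ≤ a ^ 3 + b ^ 3 := by
  rcases le_total a b with h | h
  · rw [abs_of_nonpos (by linarith), neg_sub]
    have := pow_le_pow_left₀ (by linarith : 0 ≤ b - a) (by linarith : b - a ≤ b) 3
    have := pow_nonneg ha 3
    linarith
  · rw [abs_of_nonneg (by linarith)]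
    have := pow_le_pow_left₀ (by linarith : 0 ≤ a - b) (by linarith : a - b ≤ a) 3
    have := pow_nonneg hb 3
    linarith

/-- The law of `-(K - r) * a` for a Poisson variable `K` of mean `r`. -/
def poissonLaw (r : ℝ≥0) (a : ℝ) : Measure ℝ :=
  (poissonMeasure r).map fun k : ℕ => -((k : ℝ) - r) * a

lemma isCenteredLaw_poissonLaw {r : ℝ≥0} (hr : r ≤ 1) {a : ℝ} (ha : 0 ≤ a) :
    IsCenteredLaw (poissonLaw r a) (a ^ 2 * r) (6 * a ^ 3 * r) := by
  obtain ⟨⟨i1, e1⟩, ⟨i2, e2⟩, i3, e3⟩ := integral_pow_poissonMeasure r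
  have hm : Measurable fun k : ℕ => -((k : ℝ) - r) * a := measurable_from_nat
  have hb : ∀ k : ℕ, |-((k : ℝ) - r) * a| ^ 3 ≤ a ^ 3 * ((k : ℝ) ^ 3 + r ^ 3) := fun k => by
    rw [abs_mul, abs_neg, abs_of_nonneg ha, mul_pow, mul_comm]
    exact mul_le_mul_of_nonneg_left (abs_sub_cube_le k.cast_nonneg r.coe_nonneg) (by positivity)
  have ib : Integrable (fun k : ℕ => a ^ 3 * ((k : ℝ) ^ 3 + (r : ℝ) ^ 3)) (poissonMeasure r) :=
    (i3.add (integrable_const _)).const_mul _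
  have hi : Integrable (fun k : ℕ => |-((k : ℝ) - r) * a| ^ 3) (poissonMeasure r) := by
    refine ib.mono' (Measurable.aestronglyMeasurable measurable_from_nat)
      (ae_of_all _ fun k => ?_)
    rw [Real.norm_of_nonneg (by positivity)]
    exact hb k
  refine ⟨Measure.isProbabilityMeasure_map hm.aemeasurable, ?_, ?_, ?_, ?_⟩
  · exact (integrable_map_measure (by fun_prop) hm.aemeasurable).2 hi
  · rw [poissonLaw, integral_map hm.aemeasurable (by fun_prop), integral_mul_const, integral_neg,
      integral_sub i1 (integrable_const _), e1]
    simp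
  · rw [poissonLaw, integral_map hm.aemeasurable (by fun_prop)]
    have h : ∀ k : ℕ, (-((k : ℝ) - r) * a) ^ 2 =
        a ^ 2 * ((k : ℝ) ^ 2 - 2 * r * k + r ^ 2) := fun k => by ring
    have j1 : Integrable (fun k : ℕ => (k : ℝ) ^ 2 - 2 * r * k) (poissonMeasure r) :=
      i2.sub (i1.const_mul _)
    simp only [h]
    rw [integral_const_mul, integral_add j1 (integrable_const _),
      integral_sub i2 (i1.const_mul _), integral_const_mul, e1, e2]
    simp only [integral_const, probReal_univ, one_smul]
    ring
  · rw [poissonLaw, integral_map hm.aemeasurable (by fun_prop)]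
    refine (integral_mono hi ib hb).trans ?_
    rw [integral_const_mul, integral_add i3 (integrable_const _), e3]
    simp only [integral_const, probReal_univ, one_smul]
    have hr0 : (0 : ℝ) ≤ r := r.coe_nonneg
    have hr1 : (r : ℝ) ≤ 1 := hr
    have h2 : (r : ℝ) ^ 2 ≤ r := by nlinarith
    have h3 : (r : ℝ) ^ 3 ≤ r := by nlinarith
    have ha3 : 0 ≤ a ^ 3 := by positivity
    nlinarith

end Laws

/-! ### Gauge invariance and the mean-field term -/

section Gauge

open scoped NNReal

/-- The expected free energy with independent couplings of law `ν`, at inverse temperature `b`. -/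
def meanFree {S E : Type*} [Fintype S] [Fintype E] (k : S → ℝ) (s : E → S → ℝ) (ν : Measure ℝ)
    (b : ℝ) : ℝ :=
  ∫ x, logSumExp (energy k s fun e => b * x e) ∂(Measure.pi fun _ : E => ν)

lemma integral_comp_map_pi {E X Y : Type*} [Fintype E] [MeasurableSpace X] [MeasurableSpace Y]
    {μ : Measure X} {ν : Measure Y} [SigmaFinite ν] {f : E → X → Y}
    (hf : ∀ e, MeasurePreserving (f e) μ ν) {F : (E → Y) → ℝ} (hF : Measurable F) :
    ∫ x, F (fun e => f e (x e)) ∂(Measure.pi fun _ : E => μ) =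
      ∫ y, F y ∂(Measure.pi fun _ : E => ν) := by
  have h := measurePreserving_pi (fun _ : E => μ) (fun _ : E => ν) hf
  rw [← h.map_eq, integral_map h.measurable.aemeasurable hF.aestronglyMeasurable]

variable {V : Type*}

lemma meanFree_gaussianReal {S E : Type*} [Fintype S] [Nonempty S] [Fintype E] (k : S → ℝ)
    (s : E → S → ℝ) (v : ℝ≥0) {b : ℝ} (hb : 0 ≤ b) :
    meanFree k s (gaussianReal 0 v) b = gaussFree k s fun _ => b ^ 2 * v := by
  have hc : Continuous fun x : E → ℝ => logSumExp (energy k s fun e => b * x e) :=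
    (continuous_logSumExp_energy k s).comp (by fun_prop)
  rw [meanFree, ← integral_comp_map_pi (fun _ => measurePreserving_sqrt_mul_gaussianReal v)
    hc.measurable, gaussFree]
  simp only [Real.sqrt_mul (sq_nonneg b), Real.sqrt_sq hb, mul_assoc]

lemma spin_mul_spin (a b : Bool) : spin (a == b) = spin a * spin b := by
  cases a <;> cases b <;> simp [spin]

/-- Coordinatewise product of two spin configurations. -/
def gaugeEquiv (τ : V → Bool) : (V → Bool) ≃ (V → Bool) where
  toFun σ i := σ i == τ i
  invFun σ i := σ i == τ i
  left_inv σ := by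
    funext i
    cases h : σ i <;> cases h' : τ i <;> simp [h, h']
  right_inv σ := by
    funext i
    cases h : σ i <;> cases h' : τ i <;> simp [h, h']

lemma gaugeEquiv_comm (σ τ : V → Bool) : gaugeEquiv τ σ = gaugeEquiv σ τ := by
  funext i
  simp only [gaugeEquiv, Equiv.coe_fn_mk]
  cases σ i <;> cases τ i <;> rfl

lemma pairSpin_gaugeEquiv (e : V × V) (σ τ : V → Bool) :
    pairSpin e (gaugeEquiv τ σ) = pairSpin e τ * pairSpin e σ := by
  simp only [pairSpin, gaugeEquiv, Equiv.coe_fn_mk, spin_mul_spin]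
  ring

lemma measurePreserving_pairSpin_mul (v : ℝ≥0) (e : V × V) (τ : V → Bool) :
    MeasurePreserving (fun z => pairSpin e τ * z) (gaussianReal 0 v) (gaussianReal 0 v) := by
  rcases sq_eq_one_iff.1 (pairSpin_sq e τ) with h | h
  · simp only [h, one_mul]
    exact MeasurePreserving.id _
  · simpa [h] using measurePreserving_neg_gaussianReal v

variable [Fintype V] [DecidableEq V]

lemma sum_pairSpin_eq_zero {i j : V} (h : i ≠ j) : ∑ σ, pairSpin (i, j) σ = 0 := by
  have h1 := Equiv.sum_comp (gaugeEquiv fun l => decide (l ≠ i)) (pairSpin (i, j))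
  simp only [pairSpin_gaugeEquiv, ← Finset.mul_sum] at h1
  have h2 : pairSpin (i, j) (fun l => decide (l ≠ i)) = -1 := by
    simp [pairSpin, spin, h.symm]
  rw [h2] at h1
  linarith

lemma sum_sum_spin_sq :
    ∑ σ : V → Bool, (∑ i, spin (σ i)) ^ 2 = Fintype.card V * Fintype.card (V → Bool) := by
  have h : ∀ σ : V → Bool, (∑ i, spin (σ i)) ^ 2 = ∑ i, ∑ j, pairSpin (i, j) σ := fun σ => by
    rw [sq, Finset.sum_mul_sum]
    rfl
  simp only [h]
  rw [Finset.sum_comm]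
  have h1 : ∀ i : V, ∑ σ : V → Bool, ∑ j, pairSpin (i, j) σ = Fintype.card (V → Bool) :=
    fun i => by
      rw [Finset.sum_comm, Finset.sum_eq_single i fun j _ hj => sum_pairSpin_eq_zero hj.symm]
      · simp [pairSpin, ← sq, spin_sq]
      · simp
  rw [Finset.sum_congr rfl fun i _ => h1 i]
  simp

lemma meanFree_gaugeEquiv (k : (V → Bool) → ℝ) (v : ℝ≥0) (b : ℝ) (τ : V → Bool) :
    meanFree (fun σ => k (gaugeEquiv τ σ)) pairSpin (gaussianReal 0 v) b =
      meanFree k pairSpin (gaussianReal 0 v) b := by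
  have hc : Continuous fun x : V × V → ℝ => logSumExp (energy k pairSpin fun e => b * x e) :=
    (continuous_logSumExp_energy k _).comp (by fun_prop)
  rw [meanFree, meanFree, ← integral_comp_map_pi
    (fun e => measurePreserving_pairSpin_mul v e τ) hc.measurable]
  congr 1
  funext x
  refine Eq.trans ?_ (logSumExp_comp_equiv (gaugeEquiv τ) _)
  congr 1
  funext σ
  simp only [energy, pairSpin_gaugeEquiv]
  refine congrArg (k (gaugeEquiv τ σ) + ·) (Finset.sum_congr rfl fun e _ => ?_)
  linear_combination (-(b * x e * pairSpin e σ)) * pairSpin_sq e τ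

lemma sum_le_meanFree_sub (k : (V → Bool) → ℝ) (v : ℝ≥0) (b : ℝ) :
    ∑ τ, k τ ≤ Fintype.card (V → Bool) * (meanFree k pairSpin (gaussianReal 0 v) b -
      meanFree (fun _ => 0) (pairSpin (V := V)) (gaussianReal 0 v) b) := by
  have hF := fun k : (V → Bool) → ℝ => integrable_logSumExp_energy k pairSpin_sq
    (fun _ : V × V => gaussianReal 0 v) (fun _ => integrable_id_gaussianReal 0 v) fun _ => b
  have h1 : (Fintype.card (V → Bool) : ℝ) * (meanFree k pairSpin (gaussianReal 0 v) b -
      meanFree (fun _ => 0) (pairSpin (V := V)) (gaussianReal 0 v) b) =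
      ∑ τ, (meanFree (fun σ => k (gaugeEquiv τ σ)) pairSpin (gaussianReal 0 v) b -
        meanFree (fun _ => 0) (pairSpin (V := V)) (gaussianReal 0 v) b) := by
    simp only [meanFree_gaugeEquiv, Finset.sum_const, Finset.card_univ, nsmul_eq_mul]
  have h2 : ∑ τ, (meanFree (fun σ => k (gaugeEquiv τ σ)) pairSpin (gaussianReal 0 v) b -
        meanFree (fun _ => 0) (pairSpin (V := V)) (gaussianReal 0 v) b) =
      ∫ x, ∑ τ, (logSumExp (energy (fun σ => k (gaugeEquiv τ σ)) pairSpin fun e => b * x e) -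
        logSumExp (energy (fun _ => 0) pairSpin fun e => b * x e))
        ∂(Measure.pi fun _ : V × V => gaussianReal 0 v) := by
    have hs : ∀ τ ∈ Finset.univ, Integrable (fun x =>
        logSumExp (energy (fun σ => k (gaugeEquiv τ σ)) pairSpin fun e => b * x e) -
        logSumExp (energy (fun _ => 0) pairSpin fun e => b * x e))
        (Measure.pi fun _ : V × V => gaussianReal 0 v) := fun τ _ => (hF _).sub (hF _)
    rw [integral_finsetSum _ hs]
    exact Finset.sum_congr rfl fun τ _ => (integral_sub (hF _) (hF _)).symm
  have h3 : ∑ τ, k τ = ∫ _, ∑ τ, k τ ∂(Measure.pi fun _ : V × V => gaussianReal 0 v) := by simp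
  rw [h1, h2, h3]
  refine integral_mono (integrable_const _)
    (integrable_finsetSum _ fun τ _ => (hF _).sub (hF _)) fun x => ?_
  set H := energy (fun _ : V → Bool => 0) pairSpin fun e => b * x e with hH
  have h4 : ∀ τ, gibbsAvg H (fun σ => k (gaugeEquiv τ σ)) ≤
      logSumExp (energy (fun σ => k (gaugeEquiv τ σ)) pairSpin fun e => b * x e) - logSumExp H :=
    fun τ => by
      refine le_trans (le_of_eq ?_) (gibbsAvg_sub_le _ _)
      congr 1
      funext σ
      simp [hH, energy]
  have h6 : ∀ σ, ∑ τ, k (gaugeEquiv τ σ) = ∑ τ, k τ := fun σ => by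
    simp only [gaugeEquiv_comm σ, Equiv.sum_comp]
  have h7 : ∑ τ, k τ = ∑ τ, gibbsAvg H fun σ => k (gaugeEquiv τ σ) := by
    have := gibbsAvg_sum Finset.univ H (fun _ => 1) fun τ σ => k (gaugeEquiv τ σ)
    simpa only [one_mul, h6, gibbsAvg_const] using this
  exact h7.le.trans (Finset.sum_le_sum fun τ _ => h4 τ)

/-- The antiferromagnetic mean-field energy of strength `c`. -/
def meanField (c : ℝ) (σ : V → Bool) : ℝ :=
  -(c / (2 * Fintype.card V)) * (∑ i, spin (σ i)) ^ 2

lemma abs_meanFree_meanField_sub_le [Nonempty V] {c : ℝ} (hc : 0 ≤ c) (v : ℝ≥0) (b : ℝ) :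
    |meanFree (meanField c : (V → Bool) → ℝ) pairSpin (gaussianReal 0 v) b -
      meanFree (fun _ => 0) (pairSpin (V := V)) (gaussianReal 0 v) b| ≤ c / 2 := by
  have hF := fun k : (V → Bool) → ℝ => integrable_logSumExp_energy k pairSpin_sq
    (fun _ : V × V => gaussianReal 0 v) (fun _ => integrable_id_gaussianReal 0 v) fun _ => b
  have hV : (0 : ℝ) < Fintype.card V := by exact_mod_cast Fintype.card_pos
  have hS : (0 : ℝ) < Fintype.card (V → Bool) := by exact_mod_cast Fintype.card_pos
  have h1 := sum_le_meanFree_sub (meanField c : (V → Bool) → ℝ) v b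
  have h2 : ∑ τ : V → Bool, meanField c τ = Fintype.card (V → Bool) * (-(c / 2)) := by
    simp only [meanField]
    rw [← Finset.mul_sum, sum_sum_spin_sq]
    field_simp
  rw [h2] at h1
  have h3 := le_of_mul_le_mul_left h1 hS
  have h4 : meanFree (meanField c : (V → Bool) → ℝ) pairSpin (gaussianReal 0 v) b ≤
      meanFree (fun _ => 0) (pairSpin (V := V)) (gaussianReal 0 v) b := by
    refine integral_mono (hF _) (hF _) fun x => ?_
    refine Real.log_le_log (sum_exp_pos _) (Finset.sum_le_sum fun σ _ => Real.exp_le_exp.2 ?_)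
    simp only [energy]
    have : meanField c σ ≤ 0 := by
      unfold meanField
      have : 0 ≤ c / (2 * Fintype.card V) * (∑ i, spin (σ i)) ^ 2 := by positivity
      linarith
    linarith
  rw [abs_le]
  constructor <;> linarith

end Gauge

/-! ### The squared overlap -/

section Overlap

open scoped NNReal

lemma integral_comp_curry_pi {V W X : Type*} [Fintype V] [Fintype W] [MeasurableSpace X]
    (μ : Measure X) [IsProbabilityMeasure μ] {F : (V × W → X) → ℝ} (hF : Measurable F) :
    ∫ x, F (fun e => x e.1 e.2) ∂(Measure.pi fun _ : V => Measure.pi fun _ : W => μ) =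
      ∫ x, F x ∂(Measure.pi fun _ => μ) := by
  have h := measurePreserving_curry_pi (V := V) (W := W) μ
  rw [← h.map_eq, integral_map h.measurable.aemeasurable hF.aestronglyMeasurable]

variable {n : ℕ}

lemma avg2_overlap_sq (b : ℝ) (X : Fin n → Fin n → ℝ) :
    avg2 b X (fun σ1 σ2 => overlap σ1 σ2 ^ 2) =
      1 / (n : ℝ) ^ 2 * ∑ e, gibbsAvg (fun σ => -b * Ham X σ) (pairSpin e) ^ 2 := by
  have h : ∀ σ τ : Fin n → Bool, overlap σ τ ^ 2 =
      1 / (n : ℝ) ^ 2 * ∑ e, pairSpin e σ * pairSpin e τ := fun σ τ => by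
    rw [sum_pairSpin_mul, overlap, mul_pow, one_div_pow]
  have hg : ∀ f : (Fin n → Bool) → ℝ,
      gibbsAvg (fun σ => -b * Ham X σ) f = ∑ σ, f σ * gibbs b X σ := fun f => by
    simp only [gibbsAvg, gibbs, Zpart, Finset.sum_div, mul_div_assoc]
  simp only [avg2, avg2c, h, hg]
  simp only [sq (∑ σ, _), Finset.mul_sum, Finset.sum_mul]
  rw [Finset.sum_comm (s := (Finset.univ : Finset (Fin n × Fin n)))]
  refine Finset.sum_congr rfl fun σ _ => ?_
  rw [Finset.sum_comm (s := (Finset.univ : Finset (Fin n × Fin n)))]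
  refine Finset.sum_congr rfl fun τ _ => ?_
  exact Finset.sum_congr rfl fun e _ => by ring

/-- The expected squared overlap with independent couplings of law `ν`. -/
def overlapSq (k : (Fin n → Bool) → ℝ) (ν : Measure ℝ) (b : ℝ) : ℝ :=
  1 / (n : ℝ) ^ 2 * ∑ e : Fin n × Fin n, ∫ x, gibbsAvg (energy k pairSpin fun e => b * x e)
    (pairSpin e) ^ 2 ∂(Measure.pi fun _ : Fin n × Fin n => ν)

lemma overlapSq_eq_integral (k : (Fin n → Bool) → ℝ) (ν : Measure ℝ) [IsProbabilityMeasure ν]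
    (b : ℝ) : overlapSq k ν b = ∫ x, 1 / (n : ℝ) ^ 2 * ∑ e : Fin n × Fin n,
      gibbsAvg (energy k pairSpin fun e => b * x e) (pairSpin e) ^ 2
        ∂(Measure.pi fun _ : Fin n × Fin n => ν) := by
  rw [overlapSq, integral_const_mul, integral_finsetSum _ fun e _ =>
    integrable_gibbsAvg_energy k pairSpin_sq (fun _ => ν) (fun _ => b) e 2]

lemma continuous_sum_gibbsAvg_sq (k : (Fin n → Bool) → ℝ) (b : ℝ) :
    Continuous fun x : Fin n × Fin n → ℝ => 1 / (n : ℝ) ^ 2 * ∑ e : Fin n × Fin n,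
      gibbsAvg (energy k pairSpin fun e => b * x e) (pairSpin e) ^ 2 := by
  refine continuous_const.mul (continuous_finsetSum _ fun e _ => Continuous.pow ?_ 2)
  exact (continuous_gibbsAvg_energy k pairSpin (pairSpin e)).comp
    (g := fun x => gibbsAvg (energy k pairSpin x) (pairSpin e)) (by fun_prop)

lemma integral_avg2_skMeasure (b : ℝ) :
    ∫ g, avg2 b g (fun σ1 σ2 => overlap σ1 σ2 ^ 2) ∂(skMeasure n) =
      overlapSq (n := n) (fun _ => 0) (gaussianReal 0 (1 / (2 * n))) b := by
  have hc := (continuous_sum_gibbsAvg_sq (fun _ : Fin n → Bool => 0) b).measurable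
  rw [overlapSq_eq_integral, ← integral_comp_map_pi
    (fun _ => measurePreserving_neg_gaussianReal _) hc]
  have hm : Measurable fun y : Fin n × Fin n → ℝ => fun e => -y e := by fun_prop
  refine Eq.trans ?_ (integral_comp_curry_pi _ (hc.comp hm))
  refine integral_congr_ae (ae_of_all _ fun g => ?_)
  simp only [avg2_overlap_sq]
  have h : (fun σ => -b * Ham g σ) =
      energy (fun _ => 0) pairSpin fun e => b * -(g e.1 e.2) := by
    funext σ
    simp only [Ham, energy, pairSpin, Fintype.sum_prod_type, Finset.mul_sum, zero_add]
    exact Finset.sum_congr rfl fun i _ => Finset.sum_congr rfl fun j _ => by ring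
  rw [h]

lemma sum_pairSpin {V : Type*} [Fintype V] (σ : V → Bool) :
    ∑ e, pairSpin e σ = (∑ i, spin (σ i)) ^ 2 := by
  rw [sq, Finset.sum_mul_sum, Fintype.sum_prod_type]
  rfl

lemma integral_avg2_sparseMeasure (b : ℝ) {d : ℝ} (hd : 0 < d) :
    ∫ A, avg2 (b / √d) (natMat A) (fun σ1 σ2 => overlap σ1 σ2 ^ 2) ∂(sparseMeasure n d) =
      overlapSq (n := n) (meanField (b * √d)) (poissonLaw (d / (2 * n)).toNNReal (1 / √d)) b := by
  have hc := (continuous_sum_gibbsAvg_sq (meanField (b * √d) : (Fin n → Bool) → ℝ) b).measurable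
  set r : ℝ≥0 := (d / (2 * n)).toNNReal with hr
  have hr' : (r : ℝ) = d / (2 * n) := Real.coe_toNNReal _ (by positivity)
  have hp : MeasurePreserving (fun k : ℕ => -((k : ℝ) - r) * (1 / √d)) (poissonMeasure r)
      (poissonLaw r (1 / √d)) := ⟨measurable_from_nat, rfl⟩
  have : IsProbabilityMeasure (poissonLaw r (1 / √d)) := Measure.isProbabilityMeasure_map hp.aemeasurable
  rw [overlapSq_eq_integral, ← integral_comp_map_pi (fun _ => hp) hc]
  have hm : Measurable fun y : Fin n × Fin n → ℕ => fun e => -((y e : ℝ) - r) * (1 / √d) :=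
    measurable_pi_lambda _ fun e => hp.measurable.comp (measurable_pi_apply e)
  refine Eq.trans ?_ (integral_comp_curry_pi _ (hc.comp hm))
  refine integral_congr_ae (ae_of_all _ fun A => ?_)
  simp only [avg2_overlap_sq]
  have h : (fun σ => -(b / √d) * Ham (natMat A) σ) = energy (meanField (b * √d)) pairSpin
      fun e => b * (-((A e.1 e.2 : ℝ) - r) * (1 / √d)) := by
    funext σ
    have h1 : Ham (natMat A) σ = ∑ e : Fin n × Fin n, (A e.1 e.2 : ℝ) * pairSpin e σ := by
      simp only [Ham, natMat, pairSpin, Fintype.sum_prod_type, mul_assoc]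
    have h2 : ∑ e : Fin n × Fin n, b * (-((A e.1 e.2 : ℝ) - r) * (1 / √d)) * pairSpin e σ =
        -(b / √d) * ∑ e : Fin n × Fin n, (A e.1 e.2 : ℝ) * pairSpin e σ +
          b / √d * r * (∑ i, spin (σ i)) ^ 2 := by
      rw [← sum_pairSpin, Finset.mul_sum, Finset.mul_sum, ← Finset.sum_add_distrib]
      exact Finset.sum_congr rfl fun e _ => by ring
    have h3 : b / √d * (d / (2 * n)) = b * √d / (2 * n) := by
      calc b / √d * (d / (2 * n)) = b * (d / √d) / (2 * n) := by ring
        _ = b * √d / (2 * n) := by rw [Real.div_sqrt]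
    rw [energy, h1, h2, meanField, hr', h3, Fintype.card_fin]
    ring
  rw [h]

end Overlap

/-! ### Comparison of the two models -/

section Comparison

open scoped NNReal

variable {n : ℕ}

lemma abs_freeSlope_sub_le (hn : 0 < n) (k : (Fin n → Bool) → ℝ) {ν : Measure ℝ} {ρ b : ℝ}
    (hν : IsCenteredLaw ν (1 / (2 * n)) ρ) (hb : 0 ≤ b) :
    |freeSlope k (pairSpin (V := Fin n)) ν b / n - b / 2 * (1 - overlapSq k ν b)| ≤
      b ^ 2 * (n * ρ + √(1 / (2 * n))) := by
  have hn' : (0 : ℝ) < n := by exact_mod_cast hn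
  have hv : (0 : ℝ) < 1 / (2 * n) := by positivity
  set q : Fin n × Fin n → ℝ := fun e => ∫ x, gibbsAvg (energy k pairSpin fun e => b * x e)
    (pairSpin e) ^ 2 ∂(Measure.pi fun _ : Fin n × Fin n => ν) with hq
  have h1 : ∑ e, b * (1 / (2 * n)) * (1 - q e) = n * (b / 2 * (1 - overlapSq k ν b)) := by
    rw [← Finset.mul_sum, Finset.sum_sub_distrib, overlapSq, ← hq]
    simp only [Finset.sum_const, Finset.card_univ, Fintype.card_prod, Fintype.card_fin,
      nsmul_eq_mul, Nat.cast_mul, mul_one]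
    field_simp
  have h2 : |freeSlope k (pairSpin (V := Fin n)) ν b - n * (b / 2 * (1 - overlapSq k ν b))| ≤
      n * (b ^ 2 * (n * ρ + √(1 / (2 * n)))) := by
    rw [← h1, freeSlope, ← Finset.sum_sub_distrib]
    refine (Finset.abs_sum_le_sum_abs _ _).trans ((Finset.sum_le_sum fun e _ =>
      abs_integral_mul_gibbsAvg_sub_le k pairSpin_sq hν hv hb e).trans (le_of_eq ?_))
    simp only [Finset.sum_const, Finset.card_univ, Fintype.card_prod, Fintype.card_fin,
      nsmul_eq_mul, Nat.cast_mul]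
    generalize √(1 / (2 * (n : ℝ))) = w
    field_simp
  have h3 : freeSlope k (pairSpin (V := Fin n)) ν b / n - b / 2 * (1 - overlapSq k ν b) =
      (freeSlope k (pairSpin (V := Fin n)) ν b - n * (b / 2 * (1 - overlapSq k ν b))) / n := by
    field_simp
  rw [h3, abs_div, abs_of_pos hn', div_le_iff₀ hn']
  linarith

/-- Two subgradients at `β` of functions `f` and `F` that are uniformly close differ by at most
the gap between the secant slopes of `f`, up to the uniform error. -/
lemma abs_subgradient_sub_le {f F : ℝ → ℝ} {K L β b₁ b₂ δ : ℝ} (h₁ : b₁ < β) (h₂ : β < b₂)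
    (hK : ∀ b, (b - β) * K ≤ f b - f β) (hL : ∀ b, (b - β) * L ≤ F b - F β)
    (d₁ : |F b₁ - f b₁| ≤ δ) (d₂ : |F b₂ - f b₂| ≤ δ) (d₀ : |F β - f β| ≤ δ) :
    |L - K| ≤ (f b₂ - f β) / (b₂ - β) - (f β - f b₁) / (β - b₁) +
      2 * δ * (1 / (β - b₁) + 1 / (b₂ - β)) := by
  have p₁ : 0 < β - b₁ := by linarith
  have p₂ : 0 < b₂ - β := by linarith
  rw [abs_le] at d₁ d₂ d₀
  have k₁ : (f β - f b₁) / (β - b₁) ≤ K := by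
    rw [div_le_iff₀ p₁]; linarith [hK b₁]
  have k₂ : K ≤ (f b₂ - f β) / (b₂ - β) := by
    rw [le_div_iff₀ p₂]; linarith [hK b₂]
  have l₁ : (f β - f b₁ - 2 * δ) / (β - b₁) ≤ L := by
    rw [div_le_iff₀ p₁]; linarith [hL b₁]
  have l₂ : L ≤ (f b₂ - f β + 2 * δ) / (b₂ - β) := by
    rw [le_div_iff₀ p₂]; linarith [hL b₂]
  have e₁ : (f β - f b₁ - 2 * δ) / (β - b₁) =
      (f β - f b₁) / (β - b₁) - 2 * δ * (1 / (β - b₁)) := by ring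
  have e₂ : (f b₂ - f β + 2 * δ) / (b₂ - β) =
      (f b₂ - f β) / (b₂ - β) + 2 * δ * (1 / (b₂ - β)) := by ring
  have hδ : 0 ≤ δ := by linarith
  have m₁ : 0 ≤ 2 * δ * (1 / (β - b₁)) := by positivity
  have m₂ : 0 ≤ 2 * δ * (1 / (b₂ - β)) := by positivity
  rw [abs_le]
  constructor <;> linarith

lemma meanFree_gaussianReal_eq_skPressure {b : ℝ} (hb : 0 ≤ b) :
    meanFree (fun _ => 0) (pairSpin (V := Fin n)) (gaussianReal 0 (1 / (2 * n))) b =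
      skPressure (Fin n) (b ^ 2) := by
  rw [meanFree_gaussianReal _ _ _ hb, skPressure]
  congr 1
  funext _
  simp only [Fintype.card_fin]
  push_cast
  ring

/-- The error in the comparison of the free energies per spin. -/
def freeError (b c d : ℝ) (n : ℕ) : ℝ :=
  b ^ 3 / 3 * (3 / √d + gaussianThirdMoment / 2 * √(1 / (2 * n))) + c / 2 / n

lemma isCenteredLaw_gaussian_coupling (n : ℕ) :
    IsCenteredLaw (gaussianReal 0 (1 / (2 * n))) (1 / (2 * n))
      (√(1 / (2 * n)) ^ 3 * gaussianThirdMoment) := by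
  simpa using isCenteredLaw_gaussianReal (1 / (2 * n))

lemma isCenteredLaw_poisson_coupling {d : ℝ} (hd : 0 < d) (hdn : d ≤ 2 * n) :
    IsCenteredLaw (poissonLaw (d / (2 * n)).toNNReal (1 / √d)) (1 / (2 * n))
      (3 / √d / n) := by
  have hn : (0 : ℝ) < n := by linarith
  have hs : 0 < √d := Real.sqrt_pos.2 hd
  have h := isCenteredLaw_poissonLaw (r := (d / (2 * n)).toNNReal)
    (Real.toNNReal_le_one.2 ((div_le_one (by positivity)).2 hdn)) (a := 1 / √d) (by positivity)
  rw [Real.coe_toNNReal _ (by positivity)] at h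
  have h2 : √d ^ 2 = d := Real.sq_sqrt hd.le
  have e1 : (1 / √d) ^ 2 * (d / (2 * n)) = 1 / (2 * (n : ℝ)) := by
    rw [one_div_pow, h2]; field_simp
  have e2 : 6 * (1 / √d) ^ 3 * (d / (2 * n)) = 3 / √d / (n : ℝ) := by
    rw [pow_succ (1 / √d) 2, one_div_pow, h2]; field_simp; norm_num
  rwa [e1, e2] at h

lemma gaussian_third_mul (hn : 0 < n) : n * (√(1 / (2 * n)) ^ 3 * gaussianThirdMoment) =
    gaussianThirdMoment / 2 * √(1 / (2 * n)) := by
  have hn' : (0 : ℝ) < n := by exact_mod_cast hn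
  rw [pow_succ, Real.sq_sqrt (by positivity)]
  field_simp

lemma abs_meanFree_sub_le {b c d : ℝ} (hb : 0 ≤ b) (hc : 0 ≤ c) (hd : 0 < d) (hdn : d ≤ 2 * n) :
    |meanFree (meanField c) (pairSpin (V := Fin n))
        (poissonLaw (d / (2 * n)).toNNReal (1 / √d)) b / n -
      skPressure (Fin n) (b ^ 2) / n| ≤ freeError b c d n := by
  have hn' : (0 : ℝ) < n := by linarith
  have hn : 0 < n := by exact_mod_cast hn'
  have : NeZero n := ⟨hn.ne'⟩
  have h1 := abs_integral_logSumExp_sub_le (meanField c : (Fin n → Bool) → ℝ) pairSpin_sq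
    (isCenteredLaw_poisson_coupling hd hdn) (isCenteredLaw_gaussian_coupling n) hb
  have h2 := abs_meanFree_meanField_sub_le (V := Fin n) hc (1 / (2 * n)) b
  rw [meanFree_gaussianReal_eq_skPressure hb] at h2
  rw [← sub_div, abs_div, abs_of_pos hn', div_le_iff₀ hn']
  have h3 := (abs_sub_le _ _ _).trans (add_le_add h1 h2)
  refine le_trans h3 (le_of_eq ?_)
  have h4 := gaussian_third_mul hn
  rw [freeError, ← h4]
  simp only [Fintype.card_prod, Fintype.card_fin, Nat.cast_mul]
  field_simp

end Comparison

/-! ### The limit of large degree -/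

section Limit

open scoped NNReal

variable {n : ℕ}

lemma freeError_mono {b b' c d : ℝ} (hb : 0 ≤ b) (h : b ≤ b') (n : ℕ) :
    freeError b c d n ≤ freeError b' c d n := by
  unfold freeError
  have := gaussianThirdMoment_nonneg
  gcongr

/-- The absolute difference of the two expected squared overlaps. -/
def overlapGap (β d : ℝ) (n : ℕ) : ℝ :=
  |(∫ g, avg2 β g (fun σ1 σ2 => overlap σ1 σ2 ^ 2) ∂(skMeasure n)) -
    ∫ A, avg2 (β / √d) (natMat A) (fun σ1 σ2 => overlap σ1 σ2 ^ 2) ∂(sparseMeasure n d)|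

/-- The finite-volume bound on the difference of the squared overlaps, in terms of secants of the
Sherrington–Kirkpatrick pressure. -/
def gapBound (β b₁ b₂ d : ℝ) (n : ℕ) : ℝ :=
  (skPressure (Fin n) (b₂ ^ 2) / n - skPressure (Fin n) (β ^ 2) / n) / (b₂ - β) -
    (skPressure (Fin n) (β ^ 2) / n - skPressure (Fin n) (b₁ ^ 2) / n) / (β - b₁) +
    2 * freeError b₂ (β * √d) d n * (1 / (β - b₁) + 1 / (b₂ - β)) +
    β ^ 2 * (3 / √d + √(1 / (2 * n))) +
    β ^ 2 * (gaussianThirdMoment / 2 * √(1 / (2 * n)) + √(1 / (2 * n)))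

lemma mul_overlapGap_le {β b₁ b₂ d : ℝ} (hb₁ : 0 < b₁) (h₁ : b₁ < β) (h₂ : β < b₂) (hd : 0 < d)
    (hdn : d ≤ 2 * n) : β / 2 * overlapGap β d n ≤ gapBound β b₁ b₂ d n := by
  have hn' : (0 : ℝ) < n := by linarith
  have hn : 0 < n := by exact_mod_cast hn'
  have hβ : 0 < β := hb₁.trans h₁
  have hP := isCenteredLaw_poisson_coupling hd hdn
  have hG := isCenteredLaw_gaussian_coupling n
  have := hP.isProb
  set ν := poissonLaw (d / (2 * n)).toNNReal (1 / √d) with hν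
  set k : (Fin n → Bool) → ℝ := meanField (β * √d) with hk
  have hc : 0 ≤ β * √d := by positivity
  have sP := abs_freeSlope_sub_le hn k hP hβ.le
  have sG := abs_freeSlope_sub_le hn (fun _ => 0) hG hβ.le
  rw [gaussian_third_mul hn] at sG
  rw [mul_div_cancel₀ _ hn'.ne'] at sP
  set f : ℝ → ℝ := fun b => meanFree (fun _ => 0) (pairSpin (V := Fin n))
    (gaussianReal 0 (1 / (2 * n))) b / n with hf
  set F : ℝ → ℝ := fun b => meanFree k (pairSpin (V := Fin n)) ν b / n with hF
  have hfb : ∀ b, 0 ≤ b → f b = skPressure (Fin n) (b ^ 2) / n := fun b hb => by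
    rw [hf]
    simp only [meanFree_gaussianReal_eq_skPressure hb]
  have hd' : ∀ b, 0 ≤ b → b ≤ b₂ → |F b - f b| ≤ freeError b₂ (β * √d) d n := fun b hb hb' => by
    rw [hfb b hb]
    exact (abs_meanFree_sub_le hb hc hd hdn).trans (freeError_mono hb hb' n)
  have hK : ∀ b, (b - β) * (freeSlope (fun _ => 0) (pairSpin (V := Fin n))
      (gaussianReal 0 (1 / (2 * n))) β / n) ≤ f b - f β := fun b => by
    have := freeSlope_mul_le (fun _ => 0) (pairSpin_sq (V := Fin n)) hG.integrable_id β b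
    rw [hf]
    simp only [← sub_div, ← mul_div_assoc]
    exact div_le_div_of_nonneg_right this hn'.le
  have hL : ∀ b, (b - β) * (freeSlope k (pairSpin (V := Fin n)) ν β / n) ≤ F b - F β :=
    fun b => by
      have := freeSlope_mul_le k (pairSpin_sq (V := Fin n)) hP.integrable_id β b
      rw [hF]
      simp only [← sub_div, ← mul_div_assoc]
      exact div_le_div_of_nonneg_right this hn'.le
  have hKL := abs_subgradient_sub_le h₁ h₂ hK hL (hd' b₁ hb₁.le (h₁.trans h₂).le)
    (hd' b₂ (hβ.trans h₂).le le_rfl) (hd' β hβ.le h₂.le)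
  rw [hfb b₁ hb₁.le, hfb b₂ (hβ.trans h₂).le, hfb β hβ.le] at hKL
  rw [overlapGap, integral_avg2_skMeasure, integral_avg2_sparseMeasure β hd, ← hν, ← hk,
    ← abs_of_pos (half_pos hβ), ← abs_mul, gapBound]
  rw [abs_le] at sP sG hKL ⊢
  constructor <;> linarith [sP.1, sP.2, sG.1, sG.2, hKL.1, hKL.2]

lemma tendsto_sqrt_inv : Tendsto (fun n : ℕ => √(1 / (2 * (n : ℝ)))) atTop (nhds 0) := by
  have h : Tendsto (fun n : ℕ => 1 / (2 * (n : ℝ))) atTop (nhds 0) :=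
    tendsto_const_nhds.div_atTop
      (tendsto_natCast_atTop_atTop.const_mul_atTop (by norm_num : (0 : ℝ) < 2))
  simpa using h.sqrt

lemma tendsto_gapBound {β b₁ b₂ : ℝ} (hb₁ : 0 < b₁) (h₁ : b₁ < β) (h₂ : β < b₂) (d : ℝ) :
    Tendsto (gapBound β b₁ b₂ d) atTop (nhds
      ((limPressure b₂ - limPressure β) / (b₂ - β) - (limPressure β - limPressure b₁) / (β - b₁) +
        2 * (b₂ ^ 3 / 3 * (3 / √d)) * (1 / (β - b₁) + 1 / (b₂ - β)) + β ^ 2 * (3 / √d))) := by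
  have hβ : 0 < β := hb₁.trans h₁
  have p₁ := tendsto_limPressure hb₁
  have p₂ := tendsto_limPressure (hβ.trans h₂)
  have p := tendsto_limPressure hβ
  have w := tendsto_sqrt_inv
  have hc : Tendsto (fun n : ℕ => β * √d / 2 / (n : ℝ)) atTop (nhds 0) :=
    tendsto_const_nhds.div_atTop tendsto_natCast_atTop_atTop
  have hF : Tendsto (freeError b₂ (β * √d) d) atTop
      (nhds (b₂ ^ 3 / 3 * (3 / √d + gaussianThirdMoment / 2 * 0) + 0)) :=
    (((w.const_mul _).const_add _).const_mul _).add hc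
  have h := ((((p₂.sub p).div_const (b₂ - β)).sub ((p.sub p₁).div_const (β - b₁))).add
    ((hF.const_mul 2).mul_const (1 / (β - b₁) + 1 / (b₂ - β)))).add
    ((w.const_add (3 / √d)).const_mul (β ^ 2)) |>.add
    (((w.const_mul (gaussianThirdMoment / 2)).add w).const_mul (β ^ 2))
  simp only [mul_zero, add_zero] at h
  exact h

lemma eventually_overlapGap_le {β : ℝ} (hβ : 0 < β) {ε : ℝ} (hε : 0 < ε) :
    ∀ᶠ d : ℝ in atTop, ∀ᶠ n : ℕ in atTop, overlapGap β d n ≤ ε := by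
  have hη : 0 < β * ε / 4 := by positivity
  obtain ⟨b₁, b₂, hb₁, h₁, h₂, hs⟩ := exists_secants_limPressure hβ hη
  have ht : Tendsto (fun d : ℝ => (limPressure b₂ - limPressure β) / (b₂ - β) -
      (limPressure β - limPressure b₁) / (β - b₁) +
        2 * (b₂ ^ 3 / 3 * (3 / √d)) * (1 / (β - b₁) + 1 / (b₂ - β)) + β ^ 2 * (3 / √d)) atTop
      (nhds ((limPressure b₂ - limPressure β) / (b₂ - β) -
        (limPressure β - limPressure b₁) / (β - b₁))) := by
    have hw : Tendsto (fun d : ℝ => 3 / √d) atTop (nhds 0) :=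
      tendsto_const_nhds.div_atTop Real.tendsto_sqrt_atTop
    have h := ((((hw.const_mul (b₂ ^ 3 / 3)).const_mul 2).mul_const
      (1 / (β - b₁) + 1 / (b₂ - β))).const_add ((limPressure b₂ - limPressure β) / (b₂ - β) -
        (limPressure β - limPressure b₁) / (β - b₁))).add (hw.const_mul (β ^ 2))
    simpa only [mul_zero, zero_mul, add_zero] using h
  have hlt : (limPressure b₂ - limPressure β) / (b₂ - β) -
      (limPressure β - limPressure b₁) / (β - b₁) < β * ε / 2 := by linarith
  filter_upwards [ht.eventually_lt_const hlt, eventually_gt_atTop 0] with d hd hd0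
  filter_upwards [(tendsto_gapBound hb₁ h₁ h₂ d).eventually_lt_const hd,
    (tendsto_natCast_atTop_atTop.const_mul_atTop (by norm_num : (0 : ℝ) < 2)).eventually_ge_atTop d]
    with n hn hdn
  have h := (mul_overlapGap_le hb₁ h₁ h₂ hd0 hdn).trans hn.le
  exact le_of_mul_le_mul_left (a := β / 2) (h.trans_eq (by ring)) (half_pos hβ)

lemma overlapGap_zero (d : ℝ) (n : ℕ) : overlapGap 0 d n = 0 := by
  have h : ∀ X : Fin n → Fin n → ℝ, avg2 0 X (fun σ1 σ2 => overlap σ1 σ2 ^ 2) =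
      avg2 0 (0 : Fin n → Fin n → ℝ) (fun σ1 σ2 => overlap σ1 σ2 ^ 2) := fun X => by
    simp [avg2, avg2c, gibbs, Zpart]
  have i1 : IsProbabilityMeasure (skMeasure n) := by unfold skMeasure; infer_instance
  have i2 : IsProbabilityMeasure (sparseMeasure n d) := by unfold sparseMeasure; infer_instance
  have e1 := integral_congr_ae (μ := skMeasure n) (ae_of_all _ h)
  have e2 := integral_congr_ae (μ := sparseMeasure n d) (ae_of_all _ fun A => h (natMat A))
  rw [integral_const, probReal_univ] at e1 e2
  rw [overlapGap, zero_div, e1, e2, sub_self, abs_zero]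

end Limit

end

/-- average squared-overlap correspondence between the SK model
and the sparse model in the large-degree limit. -/
theorem stmt_4 (β : ℝ) (hβ : 0 ≤ β) :
    Tendsto (fun d : ℝ =>
      limsup (fun n : ℕ =>
        |(∫ g, avg2 β g (fun σ1 σ2 => (overlap σ1 σ2) ^ 2) ∂(skMeasure n)) -
          ∫ A, avg2 (β / Real.sqrt d) (natMat A) (fun σ1 σ2 => (overlap σ1 σ2) ^ 2)
            ∂(sparseMeasure n d)|) atTop)
      atTop (nhds 0) := by
  change Tendsto (fun d : ℝ => limsup (overlapGap β d) atTop) atTop (nhds 0)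
  rcases hβ.eq_or_lt with rfl | hβ
  · have h : ∀ d, overlapGap 0 d = fun _ => 0 := fun d => funext (overlapGap_zero d)
    simp [h]
  have hgap : ∀ d n, 0 ≤ overlapGap β d n := fun d n => abs_nonneg _
  rw [Metric.tendsto_nhds]
  intro ε hε
  filter_upwards [eventually_overlapGap_le hβ (half_pos hε)] with d hd
  have h1 : limsup (overlapGap β d) atTop ≤ ε / 2 :=
    limsup_le_of_le (isCoboundedUnder_le_of_le atTop (hgap d)) hd
  have h2 : 0 ≤ limsup (overlapGap β d) atTop :=
    le_limsup_of_frequently_le (Eventually.of_forall (hgap d)).frequently ⟨ε / 2, hd⟩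
  rw [Real.dist_eq, sub_zero, abs_of_nonneg h2]
  linarith
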